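/- arXiv:2408.08587 — 4 statements merged into one kernel-verified Lean document; each statement's English description precedes it below -/
import Mathlib

section
/- Let L and P be countable dcpo's, and let L* = σ(L) and P* = σ(P) be the complete lattices (ordered by inclusion) of Scott open subsets of L and P respectively. Then the product topology of the Scott spaces ΣL* and ΣP* coincides with the Scott topology of the product poset L* × P*; that is, Σ(L* × P*) = ΣL* × ΣP*. -/
open Topology TopologicalSpace

/-- A poset is a dcpo if every nonempty directed subset has a least upper bound. -/
def IsDcpo (α : Type*) [Preorder α] : Prop :=
  ∀ D : Set α, D.Nonempty → DirectedOn (· ≤ ·) D → ∃ u, IsLUB D u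

/-- `σ(L)`, the complete lattice of Scott open subsets of `L`, realized as the lattice of
open sets of the Scott space `ΣL`. -/
abbrev ScottOpens (L : Type) [Preorder L] : Type :=
  @TopologicalSpace.Opens L (Topology.scott L Set.univ)

/-- A set is open in the Scott topology if and only if it is an upper set which is inaccessible by
directed suprema. -/
theorem isOpen_iff_isUpperSet_and_dirSupInacc {α : Type*} [Preorder α] [TopologicalSpace α]
    [Topology.IsScott α Set.univ] {s : Set α} : IsOpen s ↔ IsUpperSet s ∧ DirSupInacc s := by
  rw [← dirSupInaccOn_univ]
  exact Topology.IsScott.isOpen_iff_isUpperSet_and_dirSupInaccOn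

/-- The characterization of open sets in the Scott topology, for the topology `Topology.scott`. -/
theorem isOpen_scott_univ_iff {α : Type*} [Preorder α] {s : Set α} :
    IsOpen[Topology.scott α Set.univ] s ↔ IsUpperSet s ∧ DirSupInacc s :=
  @isOpen_iff_isUpperSet_and_dirSupInacc _ _ (Topology.scott α Set.univ)
    (@Topology.IsScott.mk _ _ _ (_) rfl) _

/-- Scott continuous maps are continuous for the Scott topologies. -/
theorem ScottContinuous.continuous_scott {α β : Type*} [Preorder α] [Preorder β] {f : α → β}
    (hf : ScottContinuous f) :
    @Continuous _ _ (Topology.scott α Set.univ) (Topology.scott β Set.univ) f := by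
  let : TopologicalSpace α := Topology.scott α Set.univ
  let : TopologicalSpace β := Topology.scott β Set.univ
  have : Topology.IsScott α Set.univ := ⟨rfl⟩
  have : Topology.IsScott β Set.univ := ⟨rfl⟩
  exact (Topology.IsScott.scottContinuousOn_iff_continuous fun _ _ _ => Set.mem_univ _).1
    (scottContinuousOn_univ.2 hf)

/-- If `e` takes values in `ℕ` and every `W n` contains the points `x` of `U` with `e x ≤ n`,
then the Scott open set `U` is the union of an increasing sequence of Scott open sets whose
`n`-th term lies in `W n`. -/
theorem exists_monotone_iSup_eq_of_forall_le_mem {X : Type*} [Preorder X]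
    [TopologicalSpace X] [Topology.IsScott X Set.univ] {e : X → ℕ} {U : Opens X} {W : ℕ → Opens X}
    (hW : ∀ n, ∀ x ∈ U, e x ≤ n → x ∈ W n) :
    ∃ A : ℕ → Opens X, Monotone A ∧ ⨆ n, A n = U ∧ ∀ n, A n ≤ W n := by
  have hopen (s : Set X) := isOpen_iff_isUpperSet_and_dirSupInacc (s := s)
  have hA (n : ℕ) : IsOpen {x | x ∈ U ∧ ∀ k, n ≤ k → x ∈ W k} := by
    rw [hopen]
    have hup (V : Opens X) : IsUpperSet (V : Set X) := ((hopen V).1 V.isOpen).1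
    refine ⟨fun x y hxy hx => ⟨hup U hxy hx.1, fun k hk => hup (W k) hxy (hx.2 k hk)⟩,
      fun d hd hd' a ha has => ?_⟩
    obtain ⟨x, hxd, hxU⟩ := ((hopen U).1 U.isOpen).2 hd hd' ha has.1
    have hfin : IsOpen (⋂ k ∈ Set.Ico n (e x), (W k : Set X)) :=
      (Set.finite_Ico n (e x)).isOpen_biInter fun k _ => (W k).isOpen
    obtain ⟨y, hyd, hy⟩ := ((hopen _).1 hfin).2 hd hd' ha
      (Set.mem_iInter₂.2 fun k hk => has.2 k hk.1)
    obtain ⟨z, hzd, hxz, hyz⟩ := hd' x hxd y hyd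
    refine ⟨z, hzd, hup U hxz hxU, fun k hk => ?_⟩
    rcases le_or_gt (e x) k with h | h
    · exact hup (W k) hxz (hW k x hxU h)
    · exact hup (W k) hyz (Set.mem_iInter₂.1 hy k ⟨hk, h⟩)
  refine ⟨fun n => ⟨_, hA n⟩, fun m n hmn x hx => ⟨hx.1, fun k hk => hx.2 k (hmn.trans hk)⟩,
    ?_, fun n x hx => hx.2 n le_rfl⟩
  refine le_antisymm (iSup_le fun n x hx => hx.1) fun x hx => ?_
  exact Opens.mem_iSup.2 ⟨e x, hx, fun k hk => hW k x hx hk⟩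

/-- The open sets containing a given finite set form a Scott open family. -/
theorem isOpen_scott_setOf_finite_subset {X : Type*} [TopologicalSpace X] {F : Set X}
    (hF : F.Finite) :
    IsOpen[Topology.scott (Opens X) Set.univ] {W : Opens X | F ⊆ W} := by
  rw [isOpen_scott_univ_iff]
  refine ⟨fun V W hVW hV => Set.Subset.trans hV hVW, fun d hd hd' a ha has => ?_⟩
  obtain rfl := ha.sSup_eq
  lift F to Finset X using hF
  refine DirectedOn.exists_mem_subset_of_finset_subset_biUnion hd hd' fun x hx => ?_
  obtain ⟨V, hV, hxV⟩ := Opens.mem_sSup.1 (has hx)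
  exact Set.mem_biUnion hV hxV

/-- Every Scott neighbourhood of a pair of open sets of countable Scott spaces contains all pairs
of open sets that include suitable finite subsets of the given ones. -/
theorem exists_finite_forall_subset_mem_of_isOpen_scott {X Y : Type*}
    [Preorder X] [TopologicalSpace X] [Topology.IsScott X Set.univ] [Countable X]
    [Preorder Y] [TopologicalSpace Y] [Topology.IsScott Y Set.univ] [Countable Y]
    {s : Set (Opens X × Opens Y)} (hs : IsOpen[Topology.scott (Opens X × Opens Y) Set.univ] s)
    {U : Opens X} {V : Opens Y} (hUV : (U, V) ∈ s) :
    ∃ F : Set X, ∃ G : Set Y, F.Finite ∧ G.Finite ∧ F ⊆ U ∧ G ⊆ V ∧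
      ∀ (U' : Opens X) (V' : Opens Y), F ⊆ U' → G ⊆ V' → (U', V') ∈ s := by
  rw [isOpen_scott_univ_iff] at hs
  obtain ⟨e, he⟩ := exists_injective_nat X
  obtain ⟨f, hf⟩ := exists_injective_nat Y
  by_contra! h
  have hbad (n : ℕ) := h {x | x ∈ U ∧ e x ≤ n} {y | y ∈ V ∧ f y ≤ n}
    (((Set.finite_Iic n).preimage he.injOn).subset fun x hx => hx.2)
    (((Set.finite_Iic n).preimage hf.injOn).subset fun y hy => hy.2)
    (fun x hx => hx.1) (fun y hy => hy.1)
  choose U' V' hU' hV' hnot using hbad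
  obtain ⟨A, hA, hAU, hAle⟩ := exists_monotone_iSup_eq_of_forall_le_mem (e := e) (U := U) (W := U')
    fun n x hx hn => hU' n ⟨hx, hn⟩
  obtain ⟨B, hB, hBV, hBle⟩ := exists_monotone_iSup_eq_of_forall_le_mem (e := f) (U := V) (W := V')
    fun n y hy hn => hV' n ⟨hy, hn⟩
  have hlub : IsLUB (Set.range fun n => (A n, B n)) (U, V) := by
    rw [← hAU, ← hBV, ← Prod.iSup_mk]
    exact isLUB_iSup
  obtain ⟨_, ⟨n, rfl⟩, hn⟩ := hs.2 (Set.range_nonempty _)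
    ((hA.prodMk hB).directed_le.directedOn_range) hlub hUV
  exact hnot n (hs.1 ⟨hAle n, hBle n⟩ hn)

/-- For countable dcpo's `L` and `P`, the Scott topology of the product poset
`σ(L) × σ(P)` coincides with the product topology of the Scott spaces `Σσ(L)` and `Σσ(P)`. -/
theorem scott_topology_prod_eq_prod_topology_of_countable_dcpos
    (L P : Type) [PartialOrder L] [PartialOrder P] [Countable L] [Countable P]
    (hL : IsDcpo L) (hP : IsDcpo P) :
    Topology.scott (ScottOpens L × ScottOpens P) Set.univ
      = @instTopologicalSpaceProd (ScottOpens L) (ScottOpens P)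
          (Topology.scott (ScottOpens L) Set.univ)
          (Topology.scott (ScottOpens P) Set.univ) := by
  let : TopologicalSpace L := Topology.scott L Set.univ
  let : TopologicalSpace P := Topology.scott P Set.univ
  have : Topology.IsScott L Set.univ := ⟨rfl⟩
  have : Topology.IsScott P Set.univ := ⟨rfl⟩
  refine le_antisymm (le_inf (continuous_iff_le_induced.1 ?_) (continuous_iff_le_induced.1 ?_)) ?_
  · exact ScottContinuous.fst.continuous_scott
  · exact ScottContinuous.snd.continuous_scott
  · intro s hs
    refine (@isOpen_prod_iff _ _ (_) (_) _).2 fun U V hUV => ?_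
    obtain ⟨F, G, hF, hG, hFU, hGV, h⟩ :=
      exists_finite_forall_subset_mem_of_isOpen_scott hs hUV
    exact ⟨_, _, isOpen_scott_setOf_finite_subset hF, isOpen_scott_setOf_finite_subset hG,
      hFU, hGV, fun W hW => h W.1 W.2 hW.1 hW.2⟩
end

section
/- Let X and Y be two countable directed determined spaces and let X* = O(X) and Y* = O(Y) be their complete lattices of open sets ordered by inclusion. Then the Scott space Σ(X* × Y*) of the product poset X* × Y* is sober. -/
open Topology TopologicalSpace

/-- A T₀ space is *directed determined* if an upper set `U` (in the specialization order
`x ≤ y ↔ x ∈ closure {y}`) is open iff for every directed subset `D` (directed in the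
specialization order), `closure D ∩ U ≠ ∅` implies `D ∩ U ≠ ∅`. -/
def DirectedDetermined (X : Type) [TopologicalSpace X] : Prop :=
  ∀ U : Set X, (∀ x y : X, x ∈ closure {y} → x ∈ U → y ∈ U) →
    (IsOpen U ↔ ∀ D : Set X, D.Nonempty → DirectedOn (fun a b => a ∈ closure {b}) D →
      (closure D ∩ U).Nonempty → (D ∩ U).Nonempty)

/-- If the open sets `u m` contain an increasing exhaustion `F m` of the open set `a` of a
directed determined space, then the tails `a ∩ ⋂ m ≥ n, u m` are open. -/
theorem DirectedDetermined.isOpen_tail {X : Type} [TopologicalSpace X] (hX : DirectedDetermined X)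
    {a : Set X} (ha : IsOpen a) {F : ℕ → Set X} (hmono : Monotone F) (hcover : a ⊆ ⋃ n, F n)
    {u : ℕ → Set X} (hu : ∀ m, IsOpen (u m)) (hF : ∀ m, F m ⊆ u m) (n : ℕ) :
    IsOpen {x | x ∈ a ∧ ∀ m, n ≤ m → x ∈ u m} := by
  have hup : ∀ {s : Set X}, IsOpen s → ∀ {x y : X}, x ∈ closure {y} → x ∈ s → y ∈ s :=
    fun hs _ _ hxy hx => (specializes_iff_mem_closure.2 hxy).mem_open hs hx
  refine (hX {x | x ∈ a ∧ ∀ m, n ≤ m → x ∈ u m} fun x y hxy hx =>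
    ⟨hup ha hxy hx.1, fun m hm => hup (hu m) hxy (hx.2 m hm)⟩).2 ?_
  rintro D - hD ⟨y, hyD, hya, hyu⟩
  obtain ⟨d, hda, hdD⟩ := mem_closure_iff.1 hyD a ha hya
  obtain ⟨j, hj⟩ := Set.mem_iUnion.1 (hcover hda)
  have hO : IsOpen (⋂ m ∈ Set.Ico n j, u m) :=
    (Set.finite_Ico n j).isOpen_biInter fun m _ => hu m
  obtain ⟨e, heO, heD⟩ := mem_closure_iff.1 hyD _ hO (Set.mem_iInter₂.2 fun m hm => hyu m hm.1)
  obtain ⟨z, hzD, hdz, hez⟩ := hD d hdD e heD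
  refine ⟨z, hzD, hup ha hdz hda, fun m hm => ?_⟩
  rcases lt_or_ge m j with hmj | hjm
  · exact hup (hu m) hez (Set.mem_iInter₂.1 heO m ⟨hm, hmj⟩)
  · exact hup (hu m) hdz (hF m (hmono hjm hj))

/-- A countable set is exhausted by an increasing sequence of finite subsets. -/
theorem exists_monotone_finite_exhaustion {X : Type*} [Countable X] (a : Set X) :
    ∃ F : ℕ → Set X, Monotone F ∧ (∀ n, (F n).Finite) ∧ (∀ n, F n ⊆ a) ∧ a ⊆ ⋃ n, F n := by
  obtain ⟨f, hf⟩ := Countable.exists_injective_nat X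
  refine ⟨fun n => {x | x ∈ a ∧ f x < n}, fun m n hmn x hx => ⟨hx.1, hx.2.trans_le hmn⟩,
    fun n => ?_, fun n x hx => hx.1, fun x hx => Set.mem_iUnion.2 ⟨f x + 1, hx, Nat.lt_succ_self _⟩⟩
  exact ((Set.finite_Iio n).preimage hf.injOn).subset fun x hx => hx.2

/-- For countable directed determined spaces, every Scott neighbourhood of a pair of open sets
contains all pairs of open sets that include suitable finite subsets. -/
theorem DirectedDetermined.exists_finite_of_mem_dirSupInacc
    {X Y : Type} [TopologicalSpace X] [TopologicalSpace Y] [Countable X] [Countable Y]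
    (hX : DirectedDetermined X) (hY : DirectedDetermined Y) {W : Set (Opens X × Opens Y)}
    (hup : IsUpperSet W) (hW : DirSupInacc W) {p : Opens X × Opens Y} (hp : p ∈ W) :
    ∃ F : Set X, ∃ G : Set Y, F.Finite ∧ G.Finite ∧ F ⊆ p.1 ∧ G ⊆ p.2 ∧
      ∀ q : Opens X × Opens Y, F ⊆ q.1 → G ⊆ q.2 → q ∈ W := by
  obtain ⟨F, hFm, hFf, hFs, hFc⟩ := exists_monotone_finite_exhaustion (p.1 : Set X)
  obtain ⟨G, hGm, hGf, hGs, hGc⟩ := exists_monotone_finite_exhaustion (p.2 : Set Y)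
  by_contra! h
  choose q hqF hqG hqW using fun n => h (F n) (G n) (hFf n) (hGf n) (hFs n) (hGs n)
  let w : ℕ → Opens X × Opens Y := fun n =>
    (⟨_, hX.isOpen_tail p.1.isOpen hFm hFc (fun m => (q m).1.isOpen) hqF n⟩,
      ⟨_, hY.isOpen_tail p.2.isOpen hGm hGc (fun m => (q m).2.isOpen) hqG n⟩)
  have hw : Monotone w := fun m n hmn =>
    ⟨fun x hx => ⟨hx.1, fun k hk => hx.2 k (hmn.trans hk)⟩,
      fun x hx => ⟨hx.1, fun k hk => hx.2 k (hmn.trans hk)⟩⟩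
  have hlub : IsLUB (Set.range w) p := by
    refine ⟨?_, fun r hr => ⟨fun x hx => ?_, fun x hx => ?_⟩⟩
    · rintro _ ⟨n, rfl⟩
      exact ⟨fun x hx => hx.1, fun x hx => hx.1⟩
    · obtain ⟨n, hn⟩ := Set.mem_iUnion.1 (hFc hx)
      exact (hr ⟨n, rfl⟩).1 ⟨hx, fun m hm => hqF m (hFm hm hn)⟩
    · obtain ⟨n, hn⟩ := Set.mem_iUnion.1 (hGc hx)
      exact (hr ⟨n, rfl⟩).2 ⟨hx, fun m hm => hqG m (hGm hm hn)⟩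
  obtain ⟨_, ⟨n, rfl⟩, hn⟩ := hW (Set.range_nonempty w) (directedOn_range.2 hw.directed_le)
    hlub hp
  have hle : w n ≤ q n := ⟨fun x hx => hx.2 n le_rfl, fun x hx => hx.2 n le_rfl⟩
  exact hqW n (hup hle hn)

/-- The pairs of open sets including given finite sets form a Scott open set. -/
theorem isOpen_setOf_finite_subset_prod_opens {X Y : Type*} [TopologicalSpace X]
    [TopologicalSpace Y] [TopologicalSpace (Opens X × Opens Y)]
    [IsScott (Opens X × Opens Y) Set.univ] {F : Set X} {G : Set Y}
    (hF : F.Finite) (hG : G.Finite) :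
    IsOpen {q : Opens X × Opens Y | F ⊆ q.1 ∧ G ⊆ q.2} := by
  have hfst : ∀ x : X, IsOpen {q : Opens X × Opens Y | x ∈ q.1} := fun x => by
    rw [IsScott.isOpen_iff_isUpperSet_and_dirSupInaccOn (D := Set.univ), dirSupInaccOn_univ]
    refine ⟨fun p q hpq hp => hpq.1 hp, fun D _ _ p hp hx => ?_⟩
    rw [Set.mem_ofPred_eq, ← (isLUB_prod.1 hp).1.sSup_eq, Opens.mem_sSup] at hx
    obtain ⟨_, ⟨q, hq, rfl⟩, hxq⟩ := hx
    exact ⟨q, hq, hxq⟩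
  have hsnd : ∀ y : Y, IsOpen {q : Opens X × Opens Y | y ∈ q.2} := fun y => by
    rw [IsScott.isOpen_iff_isUpperSet_and_dirSupInaccOn (D := Set.univ), dirSupInaccOn_univ]
    refine ⟨fun p q hpq hp => hpq.2 hp, fun D _ _ p hp hy => ?_⟩
    rw [Set.mem_ofPred_eq, ← (isLUB_prod.1 hp).2.sSup_eq, Opens.mem_sSup] at hy
    obtain ⟨_, ⟨q, hq, rfl⟩, hyq⟩ := hy
    exact ⟨q, hq, hyq⟩
  convert! (hF.isOpen_biInter fun x _ => hfst x).inter (hG.isOpen_biInter fun y _ => hsnd y)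
    using 1
  ext q
  simp [Set.subset_def]

/-- For countable directed determined spaces `X` and `Y`, the Scott space
`Σ(X* × Y*)` of the product poset of the open set lattices `X* = O(X)`, `Y* = O(Y)` is sober,
i.e. it is T₀ and every irreducible closed subset is the closure of a (unique) point. -/
theorem scottSpace_prod_opens_sober_of_directedDetermined
    (X Y : Type) [TopologicalSpace X] [TopologicalSpace Y] [T0Space X] [T0Space Y]
    [Countable X] [Countable Y] (hX : DirectedDetermined X) (hY : DirectedDetermined Y) :
    @T0Space (Opens X × Opens Y) (Topology.scott (Opens X × Opens Y) Set.univ) ∧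
    @QuasiSober (Opens X × Opens Y) (Topology.scott (Opens X × Opens Y) Set.univ) := by
  let : TopologicalSpace (Opens X × Opens Y) := Topology.scott (Opens X × Opens Y) Set.univ
  have : IsScott (Opens X × Opens Y) Set.univ := ⟨rfl⟩
  refine ⟨inferInstance, ⟨fun {S} hS hcl => ?_⟩⟩
  obtain ⟨hlower, hclosed⟩ := IsScott.isClosed_iff_isLowerSet_and_dirSupClosed.1 hcl
  have hsup : ∀ a ∈ S, ∀ b ∈ S, a ⊔ b ∈ S := by
    intro a ha b hb
    by_contra hab
    obtain ⟨F, G, hF, hG, hFab, hGab, hFG⟩ := hX.exists_finite_of_mem_dirSupInacc hY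
      hlower.compl (dirSupInacc_compl.2 hclosed) hab
    obtain ⟨c, hcS, ⟨hcFa, hcGa⟩, hcFb, hcGb⟩ := hS.2 _ _
      (isOpen_setOf_finite_subset_prod_opens (hF.inter_of_left a.1) (hG.inter_of_left a.2))
      (isOpen_setOf_finite_subset_prod_opens (hF.inter_of_left b.1) (hG.inter_of_left b.2))
      ⟨a, ha, Set.inter_subset_right, Set.inter_subset_right⟩
      ⟨b, hb, Set.inter_subset_right, Set.inter_subset_right⟩
    exact hFG c (fun x hx => (hFab hx).elim (fun h => hcFa ⟨hx, h⟩) fun h => hcFb ⟨hx, h⟩)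
      (fun y hy => (hGab hy).elim (fun h => hcGa ⟨hy, h⟩) fun h => hcGb ⟨hy, h⟩) hcS
  have hmem : sSup S ∈ S := hclosed subset_rfl hS.1
    (fun a ha b hb => ⟨a ⊔ b, hsup a ha b hb, le_sup_left, le_sup_right⟩) (isLUB_sSup S)
  refine ⟨sSup S, ?_⟩
  rw [IsGenericPoint, IsScott.closure_singleton]
  exact Set.Subset.antisymm (fun a ha => hlower ha hmem) fun a ha => le_sSup ha
end

section
/- There exist two dcpo's P₁ and P₂ such that the Scott spaces ΣP₁ and ΣP₂ are both sober, but the Scott space Σ(P₁ × P₂) of the product poset P₁ × P₂ is not sober. -/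
/-- A subset `D` is directed with respect to the relation `le`:
it is nonempty and any two elements have an upper bound in `D`. -/
def DirectedOn' {α : Type*} (le : α → α → Prop) (D : Set α) : Prop :=
  D.Nonempty ∧ ∀ x ∈ D, ∀ y ∈ D, ∃ z ∈ D, le x z ∧ le y z

/-- `u` is a least upper bound of `D` with respect to the relation `le`. -/
def IsLub' {α : Type*} (le : α → α → Prop) (D : Set α) (u : α) : Prop :=
  (∀ x ∈ D, le x u) ∧ ∀ v, (∀ x ∈ D, le x v) → le u v

/-- Every directed subset has a least upper bound: `le` makes the carrier a dcpo. -/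
def IsDcpoRel {α : Type*} (le : α → α → Prop) : Prop :=
  ∀ D : Set α, DirectedOn' le D → ∃ u, IsLub' le D u

/-- `U` is Scott open with respect to `le`: it is an upper set and every directed subset
whose least upper bound lies in `U` meets `U`. -/
def ScottOpen' {α : Type*} (le : α → α → Prop) (U : Set α) : Prop :=
  (∀ x y, le x y → x ∈ U → y ∈ U) ∧
    ∀ D u, DirectedOn' le D → IsLub' le D u → u ∈ U → (D ∩ U).Nonempty

/-- `A` is Scott closed with respect to `le`: it is a lower set and contains the least upper
bounds of its directed subsets. -/
def ScottClosed' {α : Type*} (le : α → α → Prop) (A : Set α) : Prop :=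
  (∀ x y, le x y → y ∈ A → x ∈ A) ∧
    ∀ D u, D ⊆ A → DirectedOn' le D → IsLub' le D u → u ∈ A

/-- Sobriety of the Scott space of `le`: the space is T₀ and every irreducible Scott closed
subset is the Scott closure `↓x = {y | le y x}` of a unique point `x`. -/
def SoberRel {α : Type*} (le : α → α → Prop) : Prop :=
  (∀ x y : α, (∀ U : Set α, ScottOpen' le U → (x ∈ U ↔ y ∈ U)) → x = y) ∧
    ∀ C : Set α, ScottClosed' le C → C.Nonempty →
      (∀ A B : Set α, ScottClosed' le A → ScottClosed' le B → C ⊆ A ∪ B → C ⊆ A ∨ C ⊆ B) →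
      ∃! x : α, C = {y | le y x}

section Relations

variable {α β : Type*}

theorem soberRel_of_generic [PartialOrder α]
    (h : ∀ C : Set α, ScottClosed' (· ≤ ·) C → C.Nonempty →
      (∀ A B : Set α, ScottClosed' (· ≤ ·) A → ScottClosed' (· ≤ ·) B →
        C ⊆ A ∪ B → C ⊆ A ∨ C ⊆ B) → ∃ x : α, C = {y | y ≤ x}) :
    SoberRel (α := α) (· ≤ ·) := by
  refine ⟨fun x y hxy => ?_, fun C hC hne hirr => ?_⟩
  · have hopen : ∀ y : α, ScottOpen' (· ≤ ·) {z : α | ¬ z ≤ y} := by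
      refine fun y => ⟨fun a b hab ha hb => ha (hab.trans hb), fun D u _ hu huy => ?_⟩
      by_contra hD
      exact huy (hu.2 y fun d hd => by_contra fun hdy => hD ⟨d, hd, hdy⟩)
    refine le_antisymm (by_contra fun hn => ?_) (by_contra fun hn => ?_)
    · exact (hxy _ (hopen y)).1 hn le_rfl
    · exact (hxy _ (hopen x)).2 hn le_rfl
  · obtain ⟨x, rfl⟩ := h C hC hne hirr
    refine ⟨x, rfl, fun y hy => ?_⟩
    have h1 : y ≤ x := (Set.ext_iff.1 hy y).2 le_rfl
    have h2 : x ≤ y := (Set.ext_iff.1 hy x).1 le_rfl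
    exact le_antisymm h1 h2

/-- The Scott closure of a set with respect to a relation. -/
def scottClosure (le : α → α → Prop) (G : Set α) : Set α :=
  {z | ∀ B, ScottClosed' le B → G ⊆ B → z ∈ B}

theorem subset_scottClosure (le : α → α → Prop) (G : Set α) : G ⊆ scottClosure le G :=
  fun _ hz _ _ hG => hG hz

theorem scottClosed_scottClosure (le : α → α → Prop) (G : Set α) :
    ScottClosed' le (scottClosure le G) :=
  ⟨fun x y hxy hy B hB hG => hB.1 x y hxy (hy B hB hG),
    fun D u hD hdir hu B hB hG => hB.2 D u (fun _ hd => hD hd B hB hG) hdir hu⟩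

/-- A lower set of a product is Scott closed as soon as all its slices are. -/
theorem scottClosed_prod_of_slices [PartialOrder α] [PartialOrder β] {A : Set (α × β)}
    (h₁ : ∀ y, ScottClosed' (· ≤ ·) {x | (x, y) ∈ A})
    (h₂ : ∀ x, ScottClosed' (· ≤ ·) {y | (x, y) ∈ A}) :
    ScottClosed' (fun x y : α × β => x.1 ≤ y.1 ∧ x.2 ≤ y.2) A := by
  have low : ∀ x y : α × β, x.1 ≤ y.1 ∧ x.2 ≤ y.2 → y ∈ A → x ∈ A := by
    rintro ⟨x, x'⟩ ⟨y, y'⟩ ⟨h, h'⟩ hy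
    exact (h₁ x').1 x y h ((h₂ y).1 x' y' h' hy)
  refine ⟨low, ?_⟩
  rintro D ⟨u, v⟩ hD ⟨⟨d₀, hd₀⟩, hdir⟩ ⟨hub, hlub⟩
  have hmix : ∀ d ∈ D, ∀ e ∈ D, (d.1, e.2) ∈ A := by
    intro d hd e he
    obtain ⟨z, hz, hdz, hez⟩ := hdir d hd e he
    exact low _ z ⟨hdz.1, hez.2⟩ (hD hz)
  have hu : ∀ e ∈ D, (u, e.2) ∈ A := by
    intro e he
    refine (h₁ e.2).2 (Prod.fst '' D) u ?_ ⟨⟨_, d₀, hd₀, rfl⟩, ?_⟩ ⟨?_, ?_⟩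
    · rintro _ ⟨d, hd, rfl⟩
      exact hmix d hd e he
    · rintro _ ⟨a, ha, rfl⟩ _ ⟨b, hb, rfl⟩
      obtain ⟨z, hz, haz, hbz⟩ := hdir a ha b hb
      exact ⟨_, ⟨z, hz, rfl⟩, haz.1, hbz.1⟩
    · rintro _ ⟨a, ha, rfl⟩
      exact (hub a ha).1
    · intro w hw
      exact (hlub (w, v) fun d hd => ⟨hw _ ⟨d, hd, rfl⟩, (hub d hd).2⟩).1
  refine (h₂ u).2 (Prod.snd '' D) v ?_ ⟨⟨_, d₀, hd₀, rfl⟩, ?_⟩ ⟨?_, ?_⟩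
  · rintro _ ⟨d, hd, rfl⟩
    exact hu d hd
  · rintro _ ⟨a, ha, rfl⟩ _ ⟨b, hb, rfl⟩
    obtain ⟨z, hz, haz, hbz⟩ := hdir a ha b hb
    exact ⟨_, ⟨z, hz, rfl⟩, haz.2, hbz.2⟩
  · rintro _ ⟨a, ha, rfl⟩
    exact (hub a ha).2
  · intro w hw
    exact (hlub (u, w) fun d hd => ⟨(hub d hd).1, hw _ ⟨d, hd, rfl⟩⟩).2

end Relations

/-- A family of well-ordered chains indexed by `κ`. The chain `s` converges to the point `lim s`
of `I`, or to a top element when `lim s = none`; its `k`-th member lies below the points of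
`S s k`, and these sets decrease to the empty set. -/
structure ChainSystem (I : Type) where
  κ : Type
  L : κ → Type
  [linearOrder : ∀ s, LinearOrder (L s)]
  [wellFoundedLT : ∀ s, WellFoundedLT (L s)]
  [noMaxOrder : ∀ s, NoMaxOrder (L s)]
  [nonempty : ∀ s, Nonempty (L s)]
  lim : κ → Option I
  S : ∀ s, L s → Set I
  anti : ∀ s, Antitone (S s)
  sup_mem : ∀ s (K : Set (L s)) k x, K.Nonempty → IsLUB K k → (∀ j ∈ K, x ∈ S s j) → x ∈ S s k
  exists_notMem : ∀ s x, ∃ k, x ∉ S s k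

namespace ChainSystem

attribute [instance] linearOrder wellFoundedLT noMaxOrder nonempty

variable {I : Type}

/-- The elements of the dcpo of a chain system: the points of `I`, a top element `pt none`,
and the members of the chains. -/
inductive Elt (F : ChainSystem I) : Type
  | pt (x : Option I)
  | lo (s : F.κ) (k : F.L s)

open Elt

variable {F : ChainSystem I}

inductive Elt.Le : F.Elt → F.Elt → Prop
  | top (x : F.Elt) : Le x (pt none)
  | refl (x : Option I) : Le (pt x) (pt x)
  | lim (s : F.κ) (k : F.L s) (x : Option I) (h : x = F.lim s) : Le (lo s k) (pt x)
  | mem (s : F.κ) (k : F.L s) (r : I) (h : r ∈ F.S s k) : Le (lo s k) (pt (some r))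
  | chain (s : F.κ) (k k' : F.L s) (h : k ≤ k') : Le (lo s k) (lo s k')

instance : PartialOrder F.Elt where
  le := Elt.Le
  le_refl x := by
    cases x with
    | pt x => exact .refl x
    | lo s k => exact .chain s k k le_rfl
  le_trans x y z hxy hyz := by
    cases hyz with
    | top => exact .top _
    | refl => exact hxy
    | lim s k x h =>
      cases hxy with
      | chain s k k' h' => exact .lim _ _ _ h
    | mem s k r h =>
      cases hxy with
      | chain s k k' h' => exact .mem _ _ _ (F.anti s h' h)
    | chain s k k' h =>
      cases hxy with
      | chain s j k h' => exact .chain _ _ _ (h'.trans h)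
  le_antisymm x y hxy hyx := by
    cases hxy with
    | top =>
      cases hyx with
      | top => rfl
      | refl => rfl
    | refl => rfl
    | lim => cases hyx
    | mem => cases hyx
    | chain s k k' h =>
      cases hyx with
      | chain s k k' h' => rw [le_antisymm h h']

theorem le_top' (x : F.Elt) : x ≤ pt none := Elt.Le.top x

theorem pt_le_pt {x y : Option I} : (pt x : F.Elt) ≤ pt y ↔ y = none ∨ x = y := by
  constructor
  · intro h
    cases h with
    | top => exact .inl rfl
    | refl => exact .inr rfl
  · rintro (rfl | rfl)
    exacts [.top _, .refl _]

theorem not_pt_le_lo {x : Option I} {s : F.κ} {k : F.L s} : ¬ (pt x : F.Elt) ≤ lo s k := by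
  intro h
  cases h

theorem lo_le_lo {s : F.κ} {k k' : F.L s} : lo s k ≤ lo s k' ↔ k ≤ k' := by
  constructor
  · intro h
    cases h with
    | chain s k k' h => exact h
  · exact .chain _ _ _

theorem eq_of_lo_le_lo {s s' : F.κ} {k : F.L s} {k' : F.L s'} (h : lo s k ≤ lo s' k') :
    s = s' := by
  cases h
  rfl

theorem lo_le_pt {s : F.κ} {k : F.L s} {x : Option I} :
    lo s k ≤ pt x ↔ x = none ∨ x = F.lim s ∨ ∃ r ∈ F.S s k, x = some r := by
  constructor
  · intro h
    cases h with
    | top => exact .inl rfl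
    | lim _ _ _ h => exact .inr (.inl h)
    | mem _ _ r h => exact .inr (.inr ⟨r, h, rfl⟩)
  · rintro (rfl | h | ⟨r, h, rfl⟩)
    exacts [.top _, .lim _ _ _ h, .mem _ _ _ h]

theorem isLub_image_lo {s : F.κ} {K : Set (F.L s)} {k : F.L s} (hK : K.Nonempty)
    (hk : IsLUB K k) : IsLub' (· ≤ ·) (lo s '' K) (lo s k) := by
  refine ⟨?_, fun v hv => ?_⟩
  · rintro _ ⟨j, hj, rfl⟩
    exact lo_le_lo.2 (hk.1 hj)
  · obtain ⟨j₀, hj₀⟩ := hK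
    have h₀ := hv _ ⟨j₀, hj₀, rfl⟩
    cases v with
    | lo s' k' =>
      obtain rfl := eq_of_lo_le_lo h₀
      exact lo_le_lo.2 (hk.2 fun j hj => lo_le_lo.1 (hv _ ⟨j, hj, rfl⟩))
    | pt x =>
      rw [lo_le_pt]
      by_contra! hx
      obtain ⟨r, -, rfl⟩ := (lo_le_pt.1 h₀).resolve_left hx.1 |>.resolve_left hx.2.1
      refine hx.2.2 r (F.sup_mem s K k r ⟨j₀, hj₀⟩ hk fun j hj => ?_) rfl
      obtain ⟨r', hr', h⟩ :=
        (lo_le_pt.1 (hv _ ⟨j, hj, rfl⟩)).resolve_left hx.1 |>.resolve_left hx.2.1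
      cases h
      exact hr'

theorem isLub_image_lo_of_not_bddAbove {s : F.κ} {K : Set (F.L s)} (hne : K.Nonempty)
    (hK : ¬ BddAbove K) :
    IsLub' (· ≤ ·) (lo s '' K) (pt (F.lim s)) := by
  have hlt : ∀ k, ∃ j ∈ K, k < j := by
    intro k
    by_contra! h
    exact hK ⟨k, fun j hj => h j hj⟩
  refine ⟨?_, fun v hv => ?_⟩
  · rintro _ ⟨j, -, rfl⟩
    exact lo_le_pt.2 (.inr (.inl rfl))
  · cases v with
    | lo s' k' =>
      obtain ⟨j₀, hj₀⟩ := hne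
      obtain rfl := eq_of_lo_le_lo (hv _ ⟨j₀, hj₀, rfl⟩)
      obtain ⟨j, hj, hlt⟩ := hlt k'
      exact absurd (lo_le_lo.1 (hv _ ⟨j, hj, rfl⟩)) hlt.not_ge
    | pt x =>
      rw [pt_le_pt]
      by_contra! hx
      cases x with
      | none => exact hx.1 rfl
      | some r =>
        obtain ⟨k, hk⟩ := F.exists_notMem s r
        obtain ⟨j, hj, hkj⟩ := hlt k
        obtain ⟨r', hr', h⟩ :=
          (lo_le_pt.1 (hv _ ⟨j, hj, rfl⟩)).resolve_left hx.1 |>.resolve_left (Ne.symm hx.2)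
        cases h
        exact hk (F.anti s hkj.le hr')

/-- A directed set has a greatest element or is contained in a single chain. -/
theorem exists_greatest_or_eq_image {D : Set F.Elt} (hD : DirectedOn' (· ≤ ·) D) :
    (∃ m ∈ D, ∀ x ∈ D, x ≤ m) ∨ ∃ s, ∃ K : Set (F.L s), K.Nonempty ∧ D = lo s '' K := by
  obtain ⟨⟨d₀, hd₀⟩, hdir⟩ := hD
  by_cases htop : pt none ∈ D
  · exact .inl ⟨_, htop, fun x _ => le_top' x⟩
  by_cases hpt : ∃ x, pt x ∈ D
  · obtain ⟨x, hx⟩ := hpt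
    refine .inl ⟨_, hx, fun d hd => ?_⟩
    obtain ⟨z, hz, hdz, hxz⟩ := hdir d hd _ hx
    cases z with
    | lo s k => exact absurd hxz not_pt_le_lo
    | pt y =>
      rcases pt_le_pt.1 hxz with rfl | rfl
      exacts [absurd hz htop, hdz]
  · push Not at hpt
    cases d₀ with
    | pt x => exact absurd hd₀ (hpt x)
    | lo s k₀ =>
      refine .inr ⟨s, {k | lo s k ∈ D}, ⟨k₀, hd₀⟩, Set.ext fun d => ⟨fun hd => ?_, ?_⟩⟩
      · obtain ⟨z, hz, hdz, hsz⟩ := hdir d hd _ hd₀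
        cases z with
        | pt x => exact absurd hz (hpt x)
        | lo s' k' =>
          obtain rfl := eq_of_lo_le_lo hsz
          cases d with
          | pt x => exact absurd hd (hpt x)
          | lo s' k =>
            obtain rfl := eq_of_lo_le_lo hdz
            exact ⟨k, hd, rfl⟩
      · rintro ⟨k, hk, rfl⟩
        exact hk

theorem exists_isLUB {s : F.κ} {K : Set (F.L s)} (hK : BddAbove K) : ∃ k, IsLUB K k :=
  ⟨wellFounded_lt.min (upperBounds K) hK, wellFounded_lt.min_mem _ hK,
    fun _ hj => wellFounded_lt.min_le hj⟩

theorem isDcpoRel : IsDcpoRel (α := F.Elt) (· ≤ ·) := by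
  intro D hD
  rcases exists_greatest_or_eq_image hD with ⟨m, hm, hle⟩ | ⟨s, K, hK, rfl⟩
  · exact ⟨m, hle, fun v hv => hv m hm⟩
  · by_cases hb : BddAbove K
    · obtain ⟨k, hk⟩ := exists_isLUB hb
      exact ⟨_, isLub_image_lo hK hk⟩
    · exact ⟨_, isLub_image_lo_of_not_bddAbove hK hb⟩

theorem isLub_unique {D : Set F.Elt} {u v : F.Elt} (hu : IsLub' (· ≤ ·) D u)
    (hv : IsLub' (· ≤ ·) D v) : u = v :=
  le_antisymm (hu.2 v hv.1) (hv.2 u hu.1)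

theorem directedOn_image_lo {s : F.κ} {K : Set (F.L s)} (hK : K.Nonempty) :
    DirectedOn' (· ≤ ·) (lo s '' K) := by
  refine ⟨hK.image _, ?_⟩
  rintro _ ⟨j, hj, rfl⟩ _ ⟨k, hk, rfl⟩
  rcases le_total j k with h | h
  · exact ⟨_, ⟨k, hk, rfl⟩, lo_le_lo.2 h, le_rfl⟩
  · exact ⟨_, ⟨j, hj, rfl⟩, le_rfl, lo_le_lo.2 h⟩

theorem scottClosed_of {C : Set F.Elt} (hlow : ∀ x y, x ≤ y → y ∈ C → x ∈ C)
    (hsup : ∀ s (K : Set (F.L s)) k, K.Nonempty → IsLUB K k → (∀ j ∈ K, lo s j ∈ C) → lo s k ∈ C)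
    (hlim : ∀ s, (∀ k, lo s k ∈ C) → pt (F.lim s) ∈ C) : ScottClosed' (· ≤ ·) C := by
  refine ⟨hlow, fun D u hDC hD hu => ?_⟩
  rcases exists_greatest_or_eq_image hD with ⟨m, hm, hle⟩ | ⟨s, K, hK, rfl⟩
  · exact hlow _ m (hu.2 m hle) (hDC hm)
  · by_cases hb : BddAbove K
    · obtain ⟨k, hk⟩ := exists_isLUB hb
      rw [isLub_unique hu (isLub_image_lo hK hk)]
      exact hsup s K k hK hk fun j hj => hDC ⟨j, hj, rfl⟩
    · rw [isLub_unique hu (isLub_image_lo_of_not_bddAbove hK hb)]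
      refine hlim s fun k => ?_
      obtain ⟨j, hj, hkj⟩ : ∃ j ∈ K, k < j := by
        by_contra! h
        exact hb ⟨k, fun j hj => h j hj⟩
      exact hlow _ _ (lo_le_lo.2 hkj.le) (hDC ⟨j, hj, rfl⟩)

theorem pt_lim_mem {C : Set F.Elt} (hC : ScottClosed' (· ≤ ·) C) {s : F.κ}
    (h : ∀ k, lo s k ∈ C) : pt (F.lim s) ∈ C := by
  refine hC.2 (lo s '' Set.univ) _ ?_ (directedOn_image_lo Set.univ_nonempty)
    (isLub_image_lo_of_not_bddAbove Set.univ_nonempty not_bddAbove_univ)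
  rintro _ ⟨k, -, rfl⟩
  exact h k

theorem lo_mem_of_isLUB {C : Set F.Elt} (hC : ScottClosed' (· ≤ ·) C) {s : F.κ}
    {K : Set (F.L s)} {k : F.L s} (hK : K.Nonempty) (hk : IsLUB K k) (h : ∀ j ∈ K, lo s j ∈ C) :
    lo s k ∈ C := by
  refine hC.2 (lo s '' K) _ ?_ (directedOn_image_lo hK) (isLub_image_lo hK hk)
  rintro _ ⟨k, hk, rfl⟩
  exact h k hk

theorem scottClosed_Iic (a : F.Elt) : ScottClosed' (· ≤ ·) {x | x ≤ a} :=
  ⟨fun _ _ hxy hy => hxy.trans hy, fun _ _ hD _ hu => hu.2 a fun _ hd => hD hd⟩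

/-- The points of `I` belonging to a set of elements. -/
def points (C : Set F.Elt) : Set I := {r | pt (some r) ∈ C}

/-- The part of `C` lying over the set of points `V`. -/
def part (C : Set F.Elt) (V : Set I) : Set F.Elt :=
  {c | c ∈ C ∧ match c with
    | pt x => ∀ r, x = some r → r ∈ V
    | lo s k => (∀ r ∈ points C, F.lim s = some r → r ∈ V) ∨
        ∀ j < k, ∃ y ∈ F.S s j, y ∈ points C ∧ y ∈ V}

theorem scottClosed_part {C : Set F.Elt} (hC : ScottClosed' (· ≤ ·) C) (htop : pt none ∉ C)
    {V : Set I} (hV : ∀ s, ∀ r ∈ points C, F.lim s = some r → r ∉ V →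
      ∃ k, ∀ y ∈ F.S s k, y ∈ points C → y ∉ V) :
    ScottClosed' (· ≤ ·) (part C V) := by
  refine scottClosed_of ?_ ?_ ?_
  · rintro x y hxy ⟨hyC, hy⟩
    have hxC := hC.1 x y hxy hyC
    refine ⟨hxC, ?_⟩
    cases hxy with
    | top => exact absurd hyC htop
    | refl => exact hy
    | lim s k x h => exact .inl fun r _ hr => hy r (h.trans hr)
    | mem s k r h => exact .inr fun j hj => ⟨r, F.anti s hj.le h, hyC, hy r rfl⟩
    | chain s k k' h => exact hy.imp_right fun hy j hj => hy j (hj.trans_le h)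
  · intro s K k hK hk h
    refine ⟨lo_mem_of_isLUB hC hK hk fun j hj => (h j hj).1, ?_⟩
    by_cases hl : ∀ r ∈ points C, F.lim s = some r → r ∈ V
    · exact .inl hl
    · refine .inr fun j hj => ?_
      obtain ⟨j', hj', hlt⟩ := (lt_isLUB_iff hk).1 hj
      exact ((h j' hj').2.resolve_left hl) j hlt
  · intro s h
    have hlC := pt_lim_mem hC fun k => (h k).1
    refine ⟨hlC, fun r hr => ?_⟩
    by_contra hrV
    have hrC : r ∈ points C := by
      rw [hr] at hlC
      exact hlC
    obtain ⟨k, hk⟩ := hV s r hrC hr hrV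
    obtain ⟨k', hk'⟩ := exists_gt k
    rcases (h k').2 with h' | h'
    · exact hrV (h' r hrC hr)
    · obtain ⟨y, hy, hyC, hyV⟩ := h' k hk'
      exact hk y hy hyC hyV

/-- A set of points is thin if it eventually leaves every chain converging to the top. -/
def Thin (F : ChainSystem I) (X : Set I) : Prop :=
  ∀ s, F.lim s = none → ∃ k, Disjoint (F.S s k) X

/-- `U` is relatively clopen in `X` with respect to the convergence of the chains to points. -/
def ClopenIn (F : ChainSystem I) (X U : Set I) : Prop :=
  ∀ s r, F.lim s = some r → ∃ k, ∀ y ∈ F.S s k, y ∈ X → (y ∈ U ↔ r ∈ U)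

theorem points_subsingleton {C : Set F.Elt}
    (hC : ScottClosed' (· ≤ ·) C) (htop : pt none ∉ C)
    (hirr : ∀ A B : Set F.Elt, ScottClosed' (· ≤ ·) A → ScottClosed' (· ≤ ·) B →
      C ⊆ A ∪ B → C ⊆ A ∨ C ⊆ B)
    (hsep : ∀ p q, p ≠ q → ∃ U, ClopenIn F (points C) U ∧ ¬ (p ∈ U ↔ q ∈ U)) :
    (points C).Subsingleton := by
  intro p hp q hq
  by_contra hpq
  obtain ⟨U, hU, hne⟩ := hsep p q hpq
  have h₁ : ScottClosed' (· ≤ ·) (part C U) := by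
    refine scottClosed_part hC htop fun s r _ hr hrU => ?_
    obtain ⟨k, hk⟩ := hU s r hr
    exact ⟨k, fun y hy hyC => mt (hk y hy hyC).1 hrU⟩
  have h₂ : ScottClosed' (· ≤ ·) (part C Uᶜ) := by
    refine scottClosed_part hC htop fun s r _ hr hrU => ?_
    obtain ⟨k, hk⟩ := hU s r hr
    exact ⟨k, fun y hy hyC hyU => hyU ((hk y hy hyC).2 (not_not.1 hrU))⟩
  have hcov : C ⊆ part C U ∪ part C Uᶜ := by
    intro c hc
    cases c with
    | pt x =>
      by_cases hx : ∀ r, x = some r → r ∈ U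
      · exact .inl ⟨hc, hx⟩
      · push Not at hx
        obtain ⟨r, rfl, hr⟩ := hx
        refine .inr ⟨hc, fun r' hr' => ?_⟩
        cases hr'
        exact hr
    | lo s k =>
      by_cases hx : ∀ r ∈ points C, F.lim s = some r → r ∈ U
      · exact .inl ⟨hc, .inl hx⟩
      · push Not at hx
        obtain ⟨r, -, hr, hrU⟩ := hx
        refine .inr ⟨hc, .inl fun r' _ hr' => ?_⟩
        cases hr.symm.trans hr'
        exact hrU
  rcases hirr _ _ h₁ h₂ hcov with h | h
  · exact hne (iff_of_true ((h hp).2 p rfl) ((h hq).2 q rfl))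
  · exact hne (iff_of_false ((h hp).2 p rfl) ((h hq).2 q rfl))

theorem exists_generic_of_subsingleton {C : Set F.Elt}
    (hC : ScottClosed' (· ≤ ·) C) (hne : C.Nonempty) (htop : pt none ∉ C)
    (hirr : ∀ A B : Set F.Elt, ScottClosed' (· ≤ ·) A → ScottClosed' (· ≤ ·) B →
      C ⊆ A ∪ B → C ⊆ A ∨ C ⊆ B)
    (hX : (points C).Subsingleton) : ∃ x, C = {y | y ≤ x} := by
  by_cases hall : ∀ c ∈ C, ∃ p ∈ points C, c ≤ pt (some p)
  · obtain ⟨c, hc⟩ := hne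
    obtain ⟨p, hp, -⟩ := hall c hc
    refine ⟨pt (some p), Set.ext fun y => ⟨fun hy => ?_, fun hy => hC.1 _ _ hy hp⟩⟩
    obtain ⟨q, hq, hyq⟩ := hall y hy
    rwa [hX hq hp] at hyq
  push Not at hall
  obtain ⟨c, hc, hcX⟩ := hall
  have hpt : ∀ x, pt x ∈ C → ∃ r ∈ points C, x = some r := by
    rintro (_ | r) hx
    exacts [absurd hx htop, ⟨r, hx, rfl⟩]
  cases c with
  | pt x =>
    obtain ⟨r, hr, rfl⟩ := hpt x hc
    exact absurd le_rfl (hcX r hr)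
  | lo s k =>
  have hbdd : BddAbove {j | lo s j ∈ C} := by
    by_contra hb
    have hlim := pt_lim_mem hC (s := s) fun k => by
      by_contra hk
      exact hb ⟨k, fun j hj => not_lt.1 fun h => hk (hC.1 _ _ (lo_le_lo.2 h.le) hj)⟩
    obtain ⟨r, hr, hsr⟩ := hpt _ hlim
    exact hcX r hr (lo_le_pt.2 (.inr (.inl hsr.symm)))
  obtain ⟨k₀, hk₀⟩ := exists_isLUB hbdd
  have hk₀C : lo s k₀ ∈ C := lo_mem_of_isLUB hC ⟨k, hc⟩ hk₀ fun j hj => hj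
  let B : Set F.Elt := {c | c ∈ C ∧ ((∀ j, c ≠ lo s j) ∨ ∃ p ∈ points C, c ≤ pt (some p))}
  have hB : ScottClosed' (· ≤ ·) B := by
    refine scottClosed_of ?_ ?_ ?_
    · rintro x y hxy ⟨hyC, hy⟩
      refine ⟨hC.1 _ _ hxy hyC, ?_⟩
      rcases hy with hy | ⟨p, hp, hyp⟩
      · by_contra! hx
        obtain ⟨⟨j, rfl⟩, hx⟩ := hx
        cases y with
        | pt z =>
          obtain ⟨r, hr, rfl⟩ := hpt z hyC
          exact hx r hr hxy
        | lo s' j' =>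
          obtain rfl := eq_of_lo_le_lo hxy
          exact hy _ rfl
      · exact .inr ⟨p, hp, hxy.trans hyp⟩
    · intro s' K k hK hk h
      refine ⟨lo_mem_of_isLUB hC hK hk fun j hj => (h j hj).1, ?_⟩
      by_cases hs : s' = s
      · subst hs
        have hbelow : ∀ j ∈ K, ∃ p ∈ points C, lo s' j ≤ pt (some p) := fun j hj =>
          (h j hj).2.resolve_left fun hn => hn j rfl
        obtain ⟨j₀, hj₀⟩ := hK
        obtain ⟨p, hp, -⟩ := hbelow j₀ hj₀
        refine .inr ⟨p, hp, (isLub_image_lo ⟨j₀, hj₀⟩ hk).2 _ ?_⟩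
        rintro _ ⟨j, hj, rfl⟩
        obtain ⟨q, hq, hle⟩ := hbelow j hj
        rwa [hX hq hp] at hle
      · refine .inl fun j hj => hs ?_
        cases hj
        rfl
    · intro s' h
      exact ⟨pt_lim_mem hC fun k => (h k).1, .inl fun j hj => by cases hj⟩
  have hcov : C ⊆ {x | x ≤ lo s k₀} ∪ B := by
    intro x hx
    by_cases hxB : x ∈ B
    · exact .inr hxB
    · left
      by_contra hxs
      refine hxB ⟨hx, .inl ?_⟩
      rintro j rfl
      exact hxs (lo_le_lo.2 (hk₀.1 hx))
  rcases hirr _ _ (scottClosed_Iic _) hB hcov with h | h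
  · exact ⟨_, Set.Subset.antisymm h fun y hy => hC.1 _ _ hy hk₀C⟩
  · rcases (h hc).2 with h' | ⟨p, hp, hle⟩
    exacts [absurd rfl (h' k), absurd hle (hcX p hp)]

theorem soberRel_of_separated
    (hsep : ∀ X, Thin F X → ∀ p q, p ≠ q → ∃ U, ClopenIn F X U ∧ ¬ (p ∈ U ↔ q ∈ U)) :
    SoberRel (α := F.Elt) (· ≤ ·) := by
  refine soberRel_of_generic fun C hC hne hirr => ?_
  by_cases htop : pt none ∈ C
  · exact ⟨pt none, Set.ext fun y => ⟨fun _ => le_top' y, fun hy => hC.1 _ _ hy htop⟩⟩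
  refine exists_generic_of_subsingleton hC hne htop hirr
    (points_subsingleton hC htop hirr (hsep _ fun s hs => ?_))
  by_contra! h
  refine htop (hs ▸ pt_lim_mem hC fun k => ?_)
  obtain ⟨r, hr, hrC⟩ := Set.not_disjoint_iff.1 (h k)
  exact hC.1 _ _ (lo_le_pt.2 (.inr (.inr ⟨r, hr, rfl⟩))) hrC

/-- The elements approximating a given element from below. -/
def approx : F.Elt → Set F.Elt
  | pt x => {pt x}
  | lo s k => {x | ∃ j < k, x = lo s j}

theorem scottClosed_meeting {𝒯 : Set (Set I)}
    (h𝒯 : ∀ T ∈ 𝒯, ∀ s, (∀ k, ∃ r ∈ T, (lo s k : F.Elt) ≤ pt (some r)) →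
      ∃ r ∈ T, F.lim s = some r) :
    ScottClosed' (· ≤ ·) {x : F.Elt | ∀ x' ∈ approx x, ∀ T ∈ 𝒯, ∃ r ∈ T, x' ≤ pt (some r)} := by
  refine scottClosed_of ?_ ?_ ?_
  · intro x y hxy hy
    cases x with
    | pt x =>
      cases y with
      | lo s k => exact absurd hxy not_pt_le_lo
      | pt y =>
        rintro _ rfl T hT
        obtain ⟨r, hr, hle⟩ := hy _ rfl T hT
        exact ⟨r, hr, hxy.trans hle⟩
    | lo s k =>
      rintro _ ⟨j, hj, rfl⟩ T hT
      cases y with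
      | pt y =>
        obtain ⟨r, hr, hle⟩ := hy _ rfl T hT
        exact ⟨r, hr, (lo_le_lo.2 hj.le).trans (hxy.trans hle)⟩
      | lo s' k' =>
        obtain rfl := eq_of_lo_le_lo hxy
        exact hy _ ⟨j, hj.trans_le (lo_le_lo.1 hxy), rfl⟩ T hT
  · rintro s K k hK hk h _ ⟨j, hj, rfl⟩ T hT
    obtain ⟨j', hj', hlt⟩ := (lt_isLUB_iff hk).1 hj
    exact h j' hj' _ ⟨j, hlt, rfl⟩ T hT
  · rintro s h _ rfl T hT
    obtain ⟨r, hr, hlim⟩ := h𝒯 T hT s fun k => by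
      obtain ⟨k', hk'⟩ := exists_gt k
      exact h k' _ ⟨k, hk', rfl⟩ T hT
    exact ⟨r, hr, pt_le_pt.2 (.inr hlim)⟩

/-- A chain of `E` eventually leaves every member of a chain of `F`, unless both converge to the
same point. -/
def Separates (E F : ChainSystem I) : Prop :=
  ∀ s s' k', (∃ k, Disjoint (E.S s k) (F.S s' k')) ∨ ∃ p, E.lim s = some p ∧ F.lim s' = some p

theorem Separates.exists_lim_eq {E F : ChainSystem I} (h : Separates E F) (y : F.Elt) (s : E.κ)
    (hs : ∀ k, ∃ r, y ≤ pt (some r) ∧ (lo s k : E.Elt) ≤ pt (some r)) :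
    ∃ r, y ≤ pt (some r) ∧ E.lim s = some r := by
  have hlo : ∀ {G : ChainSystem I} {s : G.κ} {k : G.L s} {r : I},
      (lo s k : G.Elt) ≤ pt (some r) ↔ G.lim s = some r ∨ r ∈ G.S s k := by
    intro G s k r
    rw [lo_le_pt]
    simp [eq_comm]
  by_contra! hn
  have hS : ∀ k, ∃ r ∈ E.S s k, y ≤ pt (some r) := by
    intro k
    obtain ⟨r, hy, hr⟩ := hs k
    exact ⟨r, (hlo.1 hr).resolve_left (hn r hy), hy⟩
  cases y with
  | pt x =>
    cases x with
    | none =>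
      obtain ⟨r, -, hr⟩ := hS (Classical.arbitrary _)
      simp [pt_le_pt] at hr
    | some x =>
      obtain ⟨k, hk⟩ := E.exists_notMem s x
      obtain ⟨r, hr, hxr⟩ := hS k
      obtain rfl : x = r := by simpa [pt_le_pt] using hxr
      exact hk hr
  | lo s' k' =>
    rcases h s s' k' with ⟨k, hk⟩ | ⟨p, hp, hp'⟩
    · have hlim : ∀ j, k ≤ j → ∃ r ∈ E.S s j, F.lim s' = some r := by
        intro j hj
        obtain ⟨r, hr, hle⟩ := hS j
        exact ⟨r, hr, (hlo.1 hle).resolve_right (Set.disjoint_left.1 hk (E.anti s hj hr))⟩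
      obtain ⟨r, -, hr⟩ := hlim k le_rfl
      obtain ⟨j, hj⟩ := E.exists_notMem s r
      obtain ⟨r', hr', hr''⟩ := hlim (max k j) (le_max_left _ _)
      cases hr.symm.trans hr''
      exact hj (E.anti s (le_max_right _ _) hr')
    · exact hn p (hlo.2 (.inl hp')) hp

/-- The order of the product of the dcpos of two chain systems. -/
abbrev prodLe (E F : ChainSystem I) (x y : E.Elt × F.Elt) : Prop := x.1 ≤ y.1 ∧ x.2 ≤ y.2

/-- The diagonal copy of `I` in the product. -/
def diagonal (E F : ChainSystem I) : Set (E.Elt × F.Elt) :=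
  Set.range fun r => (pt (some r), pt (some r))

theorem top_notMem_scottClosure_diagonal {E F : ChainSystem I} (h : Separates E F)
    (h' : Separates F E) :
    (pt none, pt none) ∉ scottClosure (prodLe E F) (diagonal E F) := by
  let A : Set (E.Elt × F.Elt) := {z | ∀ x ∈ approx z.1, ∀ y ∈ approx z.2,
    ∃ r, y ≤ pt (some r) ∧ x ≤ pt (some r)}
  have hA : ScottClosed' (prodLe E F) A := by
    refine scottClosed_prod_of_slices (fun y => ?_) fun x => ?_
    · convert scottClosed_meeting (F := E)
        (𝒯 := (fun y' => {r | y' ≤ pt (some r)}) '' approx y) ?_ using 1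
      · ext x
        simp [A]
      · rintro _ ⟨y', -, rfl⟩ s hs
        exact h.exists_lim_eq y' s hs
    · convert scottClosed_meeting (F := F)
        (𝒯 := (fun x' => {r | x' ≤ pt (some r)}) '' approx x) ?_ using 1
      · ext y
        simp only [A, Set.mem_ofPred_eq, Set.forall_mem_image]
        exact ⟨fun H x' hx' y' hy' => (H y' hy' x' hx').imp fun r hr => hr.symm,
          fun H x' hx' y' hy' => (H y' hy' hx').imp fun r hr => hr.symm⟩
      · rintro _ ⟨x', -, rfl⟩ s hs
        exact h'.exists_lim_eq x' s hs
  intro hmem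
  obtain ⟨r, hr, -⟩ := hmem A hA (by
    rintro _ ⟨r, rfl⟩ _ rfl _ rfl
    exact ⟨r, le_rfl, le_rfl⟩) _ rfl _ rfl
  simp [pt_le_pt] at hr

theorem not_soberRel_prod {E F : ChainSystem I} [Nontrivial I] (h : Separates E F)
    (h' : Separates F E)
    (hirr : ∀ A B, ScottClosed' (prodLe E F) A → ScottClosed' (prodLe E F) B →
      diagonal E F ⊆ A ∪ B → diagonal E F ⊆ A ∨ diagonal E F ⊆ B) :
    ¬ SoberRel (prodLe E F) := by
  intro hsober
  have hsub := subset_scottClosure (prodLe E F) (diagonal E F)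
  obtain ⟨p, q, hpq⟩ := exists_pair_ne I
  obtain ⟨⟨x, y⟩, hxy, -⟩ := hsober.2 _ (scottClosed_scottClosure (prodLe E F) (diagonal E F))
    ⟨_, hsub ⟨p, rfl⟩⟩ (fun A B hA hB hAB =>
      (hirr A B hA hB (hsub.trans hAB)).imp (fun hd z hz => hz A hA hd) fun hd z hz => hz B hB hd)
  have htop : ∀ {G : ChainSystem I} (z : G.Elt), (∀ r, pt (some r) ≤ z) → z = pt none := by
    intro G z hz
    cases z with
    | lo s k => exact absurd (hz p) not_pt_le_lo
    | pt z =>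
      rcases pt_le_pt.1 (hz p) with rfl | rfl
      · rfl
      · rcases pt_le_pt.1 (hz q) with h | h
        · cases h
        · cases h
          exact absurd rfl hpq
  have hle : ∀ r, prodLe E F (pt (some r), pt (some r)) (x, y) := fun r =>
    (Set.ext_iff.1 hxy _).1 (hsub ⟨r, rfl⟩)
  obtain rfl := htop x fun r => (hle r).1
  obtain rfl := htop y fun r => (hle r).2
  exact top_notMem_scottClosure_diagonal h h' ((Set.ext_iff.1 hxy _).2 ⟨le_rfl, le_rfl⟩)

end ChainSystem

/-- The chain system whose chain `s` lies below the tails of an injective family `e s`. -/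
abbrev ChainSystem.ofInjective {I : Type} (κ : Type) (L : κ → Type) [∀ s, LinearOrder (L s)]
    [∀ s, WellFoundedLT (L s)] [∀ s, NoMaxOrder (L s)] [∀ s, Nonempty (L s)]
    (lim : κ → Option I) (e : ∀ s, L s → I) (he : ∀ s, Function.Injective (e s)) :
    ChainSystem I where
  κ := κ
  L := L
  lim := lim
  S s k := e s '' Set.Ici k
  anti s _ _ h := Set.image_mono (Set.Ici_subset_Ici.2 h)
  sup_mem s K k x := by
    rintro ⟨j, hj⟩ hk hx
    obtain ⟨l, -, rfl⟩ := hx j hj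
    exact ⟨l, hk.2 fun j' hj' => by simpa [(he s).eq_iff] using hx j' hj', rfl⟩
  exists_notMem s x := by
    by_cases hx : ∃ l, e s l = x
    · obtain ⟨l, rfl⟩ := hx
      obtain ⟨k, hk⟩ := exists_gt l
      exact ⟨k, by simpa [(he s).eq_iff] using hk⟩
    · obtain ⟨k⟩ : Nonempty (L s) := inferInstance
      exact ⟨k, fun ⟨l, _, hl⟩ => hx ⟨l, hl⟩⟩

/-- Every pair `p q` of nodes carries a grid of nodes indexed by `ℕ × Ω`. -/
inductive Node (Ω : Type) : Type
  | root
  | node (p q : Node Ω) (i : ℕ) (α : Ω)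

namespace Node

variable {Ω : Type}

instance [Nonempty Ω] : Nontrivial (Node Ω) :=
  ⟨⟨root, node root root 0 (Classical.arbitrary Ω), by simp⟩⟩

/-- In the grid of `p q`, the rows converge to `p`, the columns converge to `q`, and the sequences
increasing for `<` in the first coordinate and for `r` in the second one have no limit. -/
inductive Line (r : Ω → Ω → Prop) : Type
  | row (p q : Node Ω) (i : ℕ)
  | col (p q : Node Ω) (α : Ω)
  | seq (p q : Node Ω) (σ : ℕ → ℕ × Ω) (hσ : StrictMono fun n => (σ n).1)
      (hr : ∀ m n, m < n → r (σ m).2 (σ n).2)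

namespace Line

variable {r : Ω → Ω → Prop}

def Index : Line r → Type
  | row _ _ _ => Ω
  | col _ _ _ => ℕ
  | seq _ _ _ _ _ => ℕ

instance [LinearOrder Ω] : ∀ s : Line r, LinearOrder s.Index
  | row _ _ _ => inferInstanceAs (LinearOrder Ω)
  | col _ _ _ => inferInstanceAs (LinearOrder ℕ)
  | seq _ _ _ _ _ => inferInstanceAs (LinearOrder ℕ)

instance [LinearOrder Ω] [WellFoundedLT Ω] : ∀ s : Line r, WellFoundedLT s.Index
  | row _ _ _ => inferInstanceAs (WellFoundedLT Ω)
  | col _ _ _ => inferInstanceAs (WellFoundedLT ℕ)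
  | seq _ _ _ _ _ => inferInstanceAs (WellFoundedLT ℕ)

instance [LinearOrder Ω] [NoMaxOrder Ω] : ∀ s : Line r, NoMaxOrder s.Index
  | row _ _ _ => inferInstanceAs (NoMaxOrder Ω)
  | col _ _ _ => inferInstanceAs (NoMaxOrder ℕ)
  | seq _ _ _ _ _ => inferInstanceAs (NoMaxOrder ℕ)

instance [Nonempty Ω] : ∀ s : Line r, Nonempty s.Index
  | row _ _ _ => inferInstanceAs (Nonempty Ω)
  | col _ _ _ => inferInstanceAs (Nonempty ℕ)
  | seq _ _ _ _ _ => inferInstanceAs (Nonempty ℕ)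

def lim : Line r → Option (Node Ω)
  | row p _ _ => some p
  | col _ q _ => some q
  | seq _ _ _ _ _ => none

def point : ∀ s : Line r, s.Index → Node Ω
  | row p q i, α => node p q i α
  | col p q α, i => node p q i α
  | seq p q σ _ _, n => node p q (σ n).1 (σ n).2

theorem point_injective : ∀ s : Line r, Function.Injective s.point
  | row _ _ _ => fun _ _ h => (node.inj h).2.2.2
  | col _ _ _ => fun _ _ h => (node.inj h).2.2.1
  | seq _ _ _ hσ _ => fun _ _ h => hσ.injective (node.inj h).2.2.1

end Line

variable [LinearOrder Ω] [WellFoundedLT Ω] [NoMaxOrder Ω] [Nonempty Ω]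

/-- The chain system of the lines of the grids. -/
abbrev lines (r : Ω → Ω → Prop) : ChainSystem (Node Ω) :=
  .ofInjective (Line r) Line.Index Line.lim Line.point Line.point_injective

theorem separates {r r' : Ω → Ω → Prop} (hb : ∀ s : Set Ω, s.Countable → ∃ b, ∀ a ∈ s, a < b)
    (hr : ∀ a, ¬ r a a) (hr' : ∀ a, ¬ r' a a)
    (hrr' : ∀ a b, r a b → ¬ r' a b) : (lines r).Separates (lines r') := by
  have seqCol : ∀ {r : Ω → Ω → Prop} (hr : ∀ a, ¬ r a a) {σ : ℕ → ℕ × Ω}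
      (hs : ∀ m n, m < n → r (σ m).2 (σ n).2) (α : Ω), ∃ n₀, ∀ n, (σ n).2 = α → n ≤ n₀ := by
    intro r hr σ hs α
    by_cases h : ∃ n, (σ n).2 = α
    · obtain ⟨n₀, rfl⟩ := h
      refine ⟨n₀, fun n hn => le_of_not_gt fun hlt => hr (σ n₀).2 ?_⟩
      simpa [hn] using hs _ _ hlt
    · exact ⟨0, fun n hn => absurd ⟨n, hn⟩ h⟩
  have key : ∀ (s : Line r) (s' : Line r'), (∃ k, ∀ l ≥ k, ∀ l', s.point l ≠ s'.point l') ∨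
      ∃ p, s.lim = some p ∧ s'.lim = some p := by
    rintro (⟨p, q, i⟩ | ⟨p, q, α⟩ | ⟨p, q, σ, hσ, hs⟩)
      (⟨p', q', i'⟩ | ⟨p', q', α'⟩ | ⟨p', q', σ', hσ', hs'⟩)
    · by_cases h : p = p'
      · exact .inr ⟨p, rfl, by rw [h]; rfl⟩
      · exact .inl ⟨(Classical.arbitrary Ω : Ω), fun _ _ _ hl => h (node.inj hl).1⟩
    · obtain ⟨k, hk⟩ := exists_gt α'
      refine .inl ⟨(k : Ω), fun (l : Ω) (hl : k ≤ l) l' h => ?_⟩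
      replace h := node.inj h
      exact (hk.trans_le hl).ne' h.2.2.2
    · obtain ⟨k, hk⟩ := hb (Set.range fun n => (σ' n).2) (Set.countable_range _)
      refine .inl ⟨(k : Ω), fun (l : Ω) (hl : k ≤ l) l' h => ?_⟩
      replace h := node.inj h
      exact ((hk _ ⟨l', rfl⟩).trans_le hl).ne' h.2.2.2
    · refine .inl ⟨i' + 1, fun (l : ℕ) (hl : i' + 1 ≤ l) l' h => ?_⟩
      replace h := node.inj h
      omega
    · by_cases h : q = q'
      · exact .inr ⟨q, rfl, by rw [h]; rfl⟩
      · exact .inl ⟨(0 : ℕ), fun _ _ _ hl => h (node.inj hl).2.1⟩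
    · obtain ⟨n₀, hn₀⟩ := seqCol hr' hs' α
      refine .inl ⟨(σ' n₀).1 + 1, fun (l : ℕ) (hl : (σ' n₀).1 + 1 ≤ l) (l' : ℕ) h => ?_⟩
      replace h := node.inj h
      have : (σ' l').1 ≤ (σ' n₀).1 := hσ'.monotone (hn₀ l' h.2.2.2.symm)
      omega
    · refine .inl ⟨i' + 1, fun (l : ℕ) (hl : i' + 1 ≤ l) l' h => ?_⟩
      replace h := node.inj h
      have : l ≤ (σ l).1 := hσ.le_apply
      omega
    · obtain ⟨n₀, hn₀⟩ := seqCol hr hs α'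
      refine .inl ⟨n₀ + 1, fun (l : ℕ) (hl : n₀ + 1 ≤ l) l' h => ?_⟩
      replace h := node.inj h
      have := hn₀ l h.2.2.2
      omega
    · by_cases hc : ∃ n n', σ n = σ' n'
      · obtain ⟨n₀, n₀', h₀⟩ := hc
        refine .inl ⟨n₀ + 1, fun (l : ℕ) (hl : n₀ + 1 ≤ l) (l' : ℕ) h => ?_⟩
        replace h := node.inj h
        have h1 : (σ n₀).1 < (σ l).1 := hσ hl
        have h2 : n₀' < l' := hσ'.lt_iff_lt.1 (by simpa [← h₀, ← h.2.2.1] using h1)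
        have h3 := hs' _ _ h2
        rw [← h₀, ← h.2.2.2] at h3
        exact hrr' _ _ (hs _ _ hl) h3
      · refine .inl ⟨(0 : ℕ), fun l _ l' h => hc ⟨l, l', ?_⟩⟩
        replace h := node.inj h
        exact Prod.ext h.2.2.1 h.2.2.2
  intro s s' k'
  refine (key s s').imp_left fun ⟨k, hk⟩ => ⟨k, Set.disjoint_left.2 ?_⟩
  rintro _ ⟨l, hl, rfl⟩ ⟨l', -, h⟩
  exact hk l hl l' h.symm

end Node

theorem ChainSystem.pt_lim_mem_prod {I : Type} {E F : ChainSystem I} {A : Set (E.Elt × F.Elt)}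
    (hA : ScottClosed' (prodLe E F) A) {s : E.κ} {s' : F.κ} (φ : E.L s ≃o F.L s')
    (h : ∀ k, (Elt.lo s k, Elt.lo s' (φ k)) ∈ A) : (Elt.pt (E.lim s), Elt.pt (F.lim s')) ∈ A := by
  have hE : IsLub' (· ≤ ·) (Elt.lo s '' Set.univ) _ :=
    isLub_image_lo_of_not_bddAbove Set.univ_nonempty not_bddAbove_univ
  have hF : IsLub' (· ≤ ·) ((Elt.lo s') '' Set.univ) _ :=
    isLub_image_lo_of_not_bddAbove Set.univ_nonempty not_bddAbove_univ
  refine hA.2 (Set.range fun k => (Elt.lo s k, Elt.lo s' (φ k))) _ ?_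
    ⟨Set.range_nonempty _, ?_⟩ ⟨?_, fun v hv => ⟨hE.2 _ ?_, hF.2 _ ?_⟩⟩
  · rintro _ ⟨k, rfl⟩
    exact h k
  · rintro _ ⟨k, rfl⟩ _ ⟨k', rfl⟩
    exact ⟨_, ⟨max k k', rfl⟩,
      ⟨lo_le_lo.2 (le_max_left _ _), lo_le_lo.2 (φ.monotone (le_max_left _ _))⟩,
      ⟨lo_le_lo.2 (le_max_right _ _), lo_le_lo.2 (φ.monotone (le_max_right _ _))⟩⟩
  · rintro _ ⟨k, rfl⟩
    exact ⟨hE.1 _ ⟨k, trivial, rfl⟩, hF.1 _ ⟨_, trivial, rfl⟩⟩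
  · rintro _ ⟨k, -, rfl⟩
    exact (hv _ ⟨k, rfl⟩).1
  · rintro _ ⟨k, -, rfl⟩
    simpa using (hv _ ⟨φ.symm k, rfl⟩).2

namespace Node

variable {Ω : Type} [LinearOrder Ω] [WellFoundedLT Ω] [NoMaxOrder Ω] [Nonempty Ω]

open ChainSystem

theorem lo_le_pt_point {r : Ω → Ω → Prop} (s : Line r) {k l : s.Index} (h : k ≤ l) :
    (Elt.lo s k : (lines r).Elt) ≤ Elt.pt (some (s.point l)) :=
  lo_le_pt.2 (.inr (.inr ⟨_, ⟨l, h, rfl⟩, rfl⟩))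

theorem diagonal_irreducible {r r' : Ω → Ω → Prop}
    (hb : ∀ s : Set Ω, s.Countable → ∃ b, ∀ a ∈ s, a < b)
    (A B : Set ((lines r).Elt × (lines r').Elt))
    (hA : ScottClosed' (prodLe _ _) A) (hB : ScottClosed' (prodLe _ _) B)
    (hAB : diagonal (lines r) (lines r') ⊆ A ∪ B) :
    diagonal (lines r) (lines r') ⊆ A ∨ diagonal (lines r) (lines r') ⊆ B := by
  by_contra! hn
  obtain ⟨⟨_, ⟨p, rfl⟩, hp⟩, ⟨_, ⟨q, rfl⟩, hq⟩⟩ := And.imp Set.not_subset.1 Set.not_subset.1 hn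
  have hrow : ∀ i, ∃ α : Ω, (Elt.lo (F := lines r) (.row p q i) α,
      Elt.lo (F := lines r') (.row p q i) α) ∉ A := by
    intro i
    by_contra! h
    exact hp (pt_lim_mem_prod hA (s := .row p q i) (s' := .row p q i) (.refl Ω) h)
  choose α hα using hrow
  obtain ⟨γ, hγ⟩ := hb _ (Set.countable_range α)
  obtain ⟨i, hi⟩ : ∃ i : ℕ, (Elt.lo (F := lines r) (.col p q γ) i,
      Elt.lo (F := lines r') (.col p q γ) i) ∉ B := by
    by_contra! h
    exact hq (pt_lim_mem_prod hB (s := .col p q γ) (s' := .col p q γ) (.refl ℕ) h)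
  have hαγ : α i ≤ γ := (hγ _ ⟨i, rfl⟩).le
  rcases hAB ⟨node p q i γ, rfl⟩ with h | h
  · exact hα i (hA.1 _ _ ⟨lo_le_pt_point (.row p q i) hαγ, lo_le_pt_point (.row p q i) hαγ⟩ h)
  · exact hi (hB.1 _ _ ⟨lo_le_pt_point (.col p q γ) (le_refl i),
      lo_le_pt_point (.col p q γ) (le_refl i)⟩ h)

end Node

namespace Node

open ChainSystem

variable {Ω : Type} [LinearOrder Ω]

theorem exists_finite_columns [WellFoundedLT Ω] [NoMaxOrder Ω] [Nonempty Ω] {r : Ω → Ω → Prop}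
    (hb : ∀ s : Set Ω, s.Countable → ∃ b, ∀ a ∈ s, a < b)
    (hr : ∀ s : Set Ω, ¬ s.Countable →
      ∃ f : ℕ → Ω, (∀ n, f n ∈ s) ∧ ∀ m n, m < n → r (f m) (f n))
    {X : Set (Node Ω)} (hX : Thin (lines r) X) (p q : Node Ω) :
    ∃ γ : Ω, ∀ α, γ ≤ α → {i | node p q i α ∈ X}.Finite := by
  have hE : {α | {i | node p q i α ∈ X}.Infinite}.Countable := by
    by_contra hE
    obtain ⟨f, hf, hfr⟩ := hr _ hE
    obtain ⟨φ, hφ, hφX⟩ := Filter.extraction_forall_of_frequently fun n =>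
      Nat.frequently_atTop_iff_infinite.2 (hf n)
    obtain ⟨k, hk⟩ := hX (.seq p q (fun n => (φ n, f n)) hφ hfr) rfl
    exact Set.disjoint_left.1 hk ⟨k, Set.self_mem_Ici, rfl⟩ (hφX k)
  obtain ⟨γ, hγ⟩ := hb _ hE
  exact ⟨γ, fun α hα => by_contra fun h => (hγ α h).not_ge hα⟩

/-- The node to which the lines through a node converge, up to finitely many points. -/
def parent (γ : Node Ω → Node Ω → Ω) : Node Ω → Node Ω
  | root => root
  | node p q _ α => if α < γ p q then q else p

theorem iterate_parent_eq_or_lt (γ : Node Ω → Node Ω → Ω) (n : ℕ) (y : Node Ω) :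
    (parent γ)^[n] y = y ∨ sizeOf ((parent γ)^[n] y) < sizeOf y := by
  induction n with
  | zero => exact .inl rfl
  | succ n ih =>
    rw [Function.iterate_succ_apply']
    have : ∀ z : Node Ω, parent γ z = z ∨ sizeOf (parent γ z) < sizeOf z := by
      rintro (_ | ⟨p, q, i, α⟩)
      · exact .inl rfl
      · right
        simp only [parent, node.sizeOf_spec]
        split_ifs <;> omega
    rcases this ((parent γ)^[n] y) with h | h
    · rwa [h]
    · rcases ih with ih | ih
      · exact .inr (by rwa [ih] at h ⊢)
      · exact .inr (h.trans ih)

theorem soberRel [WellFoundedLT Ω] [NoMaxOrder Ω] [Nonempty Ω] {r : Ω → Ω → Prop}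
    (hb : ∀ s : Set Ω, s.Countable → ∃ b, ∀ a ∈ s, a < b)
    (hr : ∀ s : Set Ω, ¬ s.Countable →
      ∃ f : ℕ → Ω, (∀ n, f n ∈ s) ∧ ∀ m n, m < n → r (f m) (f n)) :
    SoberRel (α := (lines r).Elt) (· ≤ ·) := by
  refine soberRel_of_separated fun X hX => ?_
  choose γ hγ using exists_finite_columns hb hr hX
  have hpar : ∀ (s : Line r) (z : Node Ω), s.lim = some z →
      ∃ k, ∀ y ∈ (lines r).S s k, y ∈ X → parent γ y = z := by
    rintro (⟨p, q, i⟩ | ⟨p, q, α⟩ | _) z hz <;> cases hz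
    · refine ⟨γ p q, ?_⟩
      rintro _ ⟨α, hα, rfl⟩ -
      exact if_neg (not_lt_of_ge hα)
    · by_cases hα : α < γ p q
      · refine ⟨(0 : ℕ), ?_⟩
        rintro _ ⟨i, -, rfl⟩ -
        exact if_pos hα
      · obtain ⟨k, hk⟩ := (hγ p q α (not_lt.1 hα)).bddAbove
        refine ⟨k + 1, ?_⟩
        rintro _ ⟨i, hi, rfl⟩ hiX
        exact absurd (hk hiX) (Nat.not_le.2 hi)
  have hclopen : ∀ p, ClopenIn (lines r) X {y | ∃ n, (parent γ)^[n] y = p} := by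
    intro p s z hz
    obtain ⟨k, hk⟩ := hpar s z hz
    obtain ⟨k', hk'⟩ := (lines r).exists_notMem s p
    refine ⟨max k k', fun y hy hyX => ?_⟩
    have hyz := hk y ((lines r).anti s (le_max_left k k') hy) hyX
    have hyp : y ≠ p := by
      rintro rfl
      exact hk' ((lines r).anti s (le_max_right k k') hy)
    constructor
    · rintro ⟨_ | n, hn⟩
      · exact absurd hn hyp
      · exact ⟨n, by rwa [Function.iterate_succ_apply, hyz] at hn⟩
    · rintro ⟨n, hn⟩
      exact ⟨n + 1, by rwa [Function.iterate_succ_apply, hyz]⟩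
  intro p q hpq
  by_cases hqp : ∃ n, (parent γ)^[n] q = p
  · refine ⟨_, hclopen q, fun h => ?_⟩
    obtain ⟨m, hm⟩ := h.2 ⟨0, rfl⟩
    obtain ⟨n, hn⟩ := hqp
    have h₁ := iterate_parent_eq_or_lt γ m p
    have h₂ := iterate_parent_eq_or_lt γ n q
    rw [hm] at h₁
    rw [hn] at h₂
    have := h₁.resolve_left hpq.symm
    have := h₂.resolve_left hpq
    omega
  · exact ⟨_, hclopen p, fun h => hqp (h.1 ⟨0, rfl⟩)⟩

end Node

open Topology in
theorem exists_strictMono_mem_of_not_countable {s : Set ℝ} (hs : ¬ s.Countable) :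
    ∃ f : ℕ → ℝ, StrictMono f ∧ ∀ n, f n ∈ s := by
  obtain ⟨x, -, hacc⟩ : ∃ x ∈ s, 𝓝[s ∩ Set.Iio x] x ≠ ⊥ := by
    by_contra! h
    refine hs ((countable_setOfPred_isolated_left_within (s := s)).mono ?_)
    exact fun x hx => ⟨hx, h x hx⟩
  have hstep : ∀ y < x, ∃ z ∈ s, y < z ∧ z < x := by
    intro y hy
    have : (𝓝[s ∩ Set.Iio x] x).NeBot := ⟨hacc⟩
    have hmem : Set.Ioi y ∩ (s ∩ Set.Iio x) ∈ 𝓝[s ∩ Set.Iio x] x :=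
      Filter.inter_mem (mem_nhdsWithin_of_mem_nhds (Ioi_mem_nhds hy)) self_mem_nhdsWithin
    obtain ⟨z, hyz, hz⟩ := Filter.nonempty_of_mem hmem
    exact ⟨z, hz.1, hyz, hz.2⟩
  choose! g hgs hyg hgx using hstep
  have hlt : ∀ n, g^[n] (x - 1) < x := by
    intro n
    induction n with
    | zero => exact sub_one_lt x
    | succ n ih => exact Function.iterate_succ_apply' g n _ ▸ hgx _ ih
  refine ⟨fun n => g^[n + 1] (x - 1), strictMono_nat_of_lt_succ fun n => ?_, fun n => ?_⟩
  · exact Function.iterate_succ_apply' g (n + 1) _ ▸ hyg _ (hlt _)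
  · simpa only [Function.iterate_succ_apply'] using hgs _ (hlt n)

theorem exists_increasing_of_not_countable {Ω : Type} {ρ : Ω → ℝ} (hρ : Function.Injective ρ)
    (s : Set Ω) (hs : ¬ s.Countable) :
    ∃ f : ℕ → Ω, (∀ n, f n ∈ s) ∧ ∀ m n, m < n → ρ (f m) < ρ (f n) := by
  obtain ⟨f, hf, hfs⟩ := exists_strictMono_mem_of_not_countable
    fun h : (ρ '' s).Countable => hs (Set.countable_of_injective_of_countable_image hρ.injOn h)
  choose g hgs hg using hfs
  exact ⟨g, hgs, fun m n hmn => by simpa [hg] using hf hmn⟩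

open Cardinal Ordinal in
theorem exists_wellOrder_injective_real : ∃ (Ω : Type) (_ : LinearOrder Ω),
    WellFoundedLT Ω ∧ (∀ s : Set Ω, s.Countable → ∃ b, ∀ a ∈ s, a < b) ∧
      ∃ ρ : Ω → ℝ, Function.Injective ρ := by
  refine ⟨(ω₁ : Ordinal.{0}).ToType, inferInstance, inferInstance, fun s hs => ?_, ?_⟩
  · by_contra! h
    have hcof := Order.cof_le (s := s) h
    rw [cof_toType, cof_omega_one] at hcof
    exact (hcof.trans hs.le_aleph0).not_gt aleph0_lt_aleph_one
  · have : #(ω₁ : Ordinal.{0}).ToType ≤ #ℝ := by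
      simpa [mk_real] using aleph_one_le_continuum
    obtain ⟨ρ⟩ := this
    exact ⟨ρ, ρ.injective⟩

/-- There exist two dcpo's `P₁` and `P₂` whose Scott spaces are both sober, while
the Scott space of the product poset `P₁ × P₂` (componentwise order) is not sober. -/
theorem exists_sober_dcpos_with_nonsober_product :
    ∃ (α β : Type) (le₁ : α → α → Prop) (le₂ : β → β → Prop),
      IsPartialOrder α le₁ ∧ IsPartialOrder β le₂ ∧
      IsDcpoRel le₁ ∧ IsDcpoRel le₂ ∧
      SoberRel le₁ ∧ SoberRel le₂ ∧
      ¬ SoberRel (fun x y : α × β => le₁ x.1 y.1 ∧ le₂ x.2 y.2) := by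
  obtain ⟨Ω, _, _, hb, ρ, hρ⟩ := exists_wellOrder_injective_real
  have : Nonempty Ω := (hb ∅ Set.countable_empty).nonempty
  have : NoMaxOrder Ω := ⟨fun a => by simpa using hb {a} (Set.countable_singleton a)⟩
  refine ⟨(Node.lines fun a b => ρ a < ρ b).Elt, (Node.lines fun a b => -ρ a < -ρ b).Elt,
    (· ≤ ·), (· ≤ ·), inferInstance, inferInstance, ChainSystem.isDcpoRel, ChainSystem.isDcpoRel,
    Node.soberRel hb (exists_increasing_of_not_countable hρ),
    Node.soberRel hb (exists_increasing_of_not_countable (neg_injective.comp hρ)),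
    ChainSystem.not_soberRel_prod ?_ ?_ (Node.diagonal_irreducible hb)⟩
  · exact Node.separates hb (fun _ => lt_irrefl _) (fun _ => lt_irrefl _)
      fun _ _ h => (neg_lt_neg h).not_gt
  · exact Node.separates hb (fun _ => lt_irrefl _) (fun _ => lt_irrefl _)
      fun _ _ h => (neg_lt_neg_iff.1 h).not_gt
end

section
/- For the dcpo's P₁ and P₂ described in the context, the set A = ↓{(a,a) : a ∈ max B} ⊆ P₁ × P₂ (the lower set, in the product order, generated by the diagonal copies of the maximal elements of B) is an irreducible closed subset of the Scott space Σ(P₁ × P₂) that is not of the form ↓x for any x ∈ P₁ × P₂. -/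
/-! ### The posets `M`, `L`, `B`, `P₁`, `P₂` of Miao, Xi, Jia, Li, Zhao -/

/-- `ℕ^{<ℕ}`: nonempty finite words over `ℕ`. -/
abbrev NWord : Type := {l : List ℕ // l ≠ []}

/-- The prefix order on nonempty finite words. -/
def wordLE (v w : NWord) : Prop := v.1 <+: w.1

/-- The word of length 1 corresponding to a natural number. -/
def word1 (k : ℕ) : NWord := ⟨[k], by simp⟩

/-- `s.k`: the word `s` extended by the letter `k`. -/
def wordSnoc (s : NWord) (k : ℕ) : NWord := ⟨s.1 ++ [k], by simp⟩

/-- The poset `M = ℕ ⊔ ℕ^{<ℕ}`, the disjoint sum of `ℕ` and the words. -/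
abbrev Mt : Type := ℕ ⊕ NWord

/-- The (disjoint sum) order on `M`. -/
def Mle : Mt → Mt → Prop
  | Sum.inl a, Sum.inl b => a ≤ b
  | Sum.inr v, Sum.inr w => wordLE v w
  | _, _ => False

/-- The strict order on `M`. -/
def Mlt (x y : Mt) : Prop := Mle x y ∧ x ≠ y

/-- Pairs `(a, b)` of naturals with `a < b`. -/
abbrev Pairt : Type := {p : ℕ × ℕ // p.1 < p.2}

/-- The poset `L = ({(a,b) : a < b} × M) ∪ {⊤}`; `none` is the top element `⊤` and
`some (p, x)` is the element `x_{a,b}` for `p = (a,b)`. -/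
abbrev Lt : Type := Option (Pairt × Mt)

/-- The strict order on `L`: everything (other than `⊤`) is strictly below `⊤ = none`, and
`x_{a,b} < y_{a,b}` iff `x < y` in `M` (with the same tag `(a,b)`). -/
def Llt (u v : Lt) : Prop :=
  (u ≠ none ∧ v = none) ∨ ∃ p x y, u = some (p, x) ∧ v = some (p, y) ∧ Mlt x y

/-- The carrier of the poset `B = ℕ × ℕ × L`. -/
abbrev Bt : Type := ℕ × ℕ × Lt

/-- `⊏₁`: `(m, n, ℓ) ⊏₁ (m, n, ℓ')` whenever `ℓ < ℓ'` in `L`. -/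
def sq1 : Bt → Bt → Prop := fun x y =>
  ∃ m n u v, x = (m, n, u) ∧ y = (m, n, v) ∧ Llt u v

/-- `⊏₂`: `(a, n, x_{a,b}) ⊏₂ (f_{a,b}(x), n+1, ⊤)` for a word `x ∈ ℕ^{<ℕ}`. -/
def sq2 (f : Pairt → NWord → ℕ) : Bt → Bt → Prop := fun x y =>
  ∃ (n : ℕ) (p : Pairt) (w : NWord),
    x = (p.1.1, n, some (p, Sum.inr w)) ∧ y = (f p w, n + 1, (none : Lt))

/-- `⊏₃`: `(b, n, x_{a,b}) ⊏₃ (f_{a,b}(x), n+1, ⊤)` for `x ∈ ℕ`, regarded as a word of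
length 1. -/
def sq3 (f : Pairt → NWord → ℕ) : Bt → Bt → Prop := fun x y =>
  ∃ (n k : ℕ) (p : Pairt),
    x = (p.1.2, n, some (p, Sum.inl k)) ∧ y = (f p (word1 k), n + 1, (none : Lt))

/-- `⊏₄`: `(f_{a,b}(s), n, x_{a,b}) ⊏₄ (f_{a,b}(s.x), n, ⊤)` for a word `s` and `x ∈ ℕ`. -/
def sq4 (f : Pairt → NWord → ℕ) : Bt → Bt → Prop := fun x y =>
  ∃ (n k : ℕ) (p : Pairt) (s : NWord),
    x = (f p s, n, some (p, Sum.inl k)) ∧ y = (f p (wordSnoc s k), n, (none : Lt))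

/-- `⊏ = ⊏₁ ∪ ⊏₂ ∪ ⊏₃ ∪ ⊏₄ ∪ ⊏₁;⊏₂ ∪ ⊏₁;⊏₃ ∪ ⊏₁;⊏₄`. -/
def Bsq (f : Pairt → NWord → ℕ) : Bt → Bt → Prop := fun x y =>
  sq1 x y ∨ sq2 f x y ∨ sq3 f x y ∨ sq4 f x y ∨
    (∃ z, sq1 x z ∧ sq2 f z y) ∨ (∃ z, sq1 x z ∧ sq3 f z y) ∨ (∃ z, sq1 x z ∧ sq4 f z y)

/-- The order `⊑` on `B`: the reflexive closure of `⊏`. -/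
def Ble (f : Pairt → NWord → ℕ) (x y : Bt) : Prop := x = y ∨ Bsq f x y

/-- The hypotheses on the data `i`, `f`: `i` is an injection into `P(ℕ)` with pairwise
disjoint values satisfying `n < k` for all `k ∈ i (m, n)`, and each `f_{a,b}` is a monotone
injection of `ℕ^{<ℕ}` (with the prefix order) into `i (a, b)`. -/
structure IFData (i : Pairt → Set ℕ) (f : Pairt → NWord → ℕ) : Prop where
  inj : Function.Injective i
  disj : ∀ p q : Pairt, p ≠ q → i p ∩ i q = ∅
  gt : ∀ p : Pairt, ∀ k ∈ i p, p.1.2 < k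
  mem : ∀ p w, f p w ∈ i p
  finj : ∀ p, Function.Injective (f p)
  fmono : ∀ p v w, wordLE v w → f p v ≤ f p w

/-- The carrier of the poset `P₁ = (ℕ^ℕ × ℕ) ∪ B ∪ {⊤₁}`. -/
abbrev P1t : Type := ((ℕ → ℕ) × ℕ) ⊕ Bt ⊕ Unit

/-- The top element `⊤₁` of `P₁`. -/
def P1top : P1t := Sum.inr (Sum.inr ())

/-- The inclusion of `B` into `P₁`. -/
def P1ofB (b : Bt) : P1t := Sum.inr (Sum.inl b)

/-- The strict order `<₁ ∪ <₂ ∪ <₃ ∪ <₄ ∪ <₁;<₃` of `P₁`: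
`(g, n) <₁ (g, m)` iff `n < m`; `<₂` is `⊏` on `B`; `(g, n) <₃ (g(n), n, ⊤)`;
`x <₄ ⊤₁` for `x ≠ ⊤₁`; and `(g, n) <₁;<₃ (g(m), m, ⊤)` for `n < m`. -/
def P1lt (f : Pairt → NWord → ℕ) : P1t → P1t → Prop := fun x y =>
  (∃ (g : ℕ → ℕ) (n m : ℕ), x = Sum.inl (g, n) ∧ y = Sum.inl (g, m) ∧ n < m) ∨
  (∃ b c : Bt, x = P1ofB b ∧ y = P1ofB c ∧ Bsq f b c) ∨
  (∃ (g : ℕ → ℕ) (n : ℕ), x = Sum.inl (g, n) ∧ y = P1ofB (g n, n, (none : Lt))) ∨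
  (x ≠ P1top ∧ y = P1top) ∨
  (∃ (g : ℕ → ℕ) (n m : ℕ), x = Sum.inl (g, n) ∧ n < m ∧ y = P1ofB (g m, m, (none : Lt)))

/-- The order of `P₁`: the reflexive closure of the strict order. -/
def P1le (f : Pairt → NWord → ℕ) (x y : P1t) : Prop := x = y ∨ P1lt f x y

/-- `X = {g : ℕ → ⋃ₙ Eₙ : g(n) ∈ Eₙ}` where `Eₙ = i(φ(n))`. -/
def Xt (i : Pairt → Set ℕ) (φ : ℕ → Pairt) : Type := {g : ℕ → ℕ // ∀ n, g n ∈ i (φ n)}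

/-- The carrier of the poset `P₂ = (X × ℕ × ℕ) ∪ B ∪ {⊤₂}`. -/
abbrev P2t (i : Pairt → Set ℕ) (φ : ℕ → Pairt) : Type := (Xt i φ × ℕ × ℕ) ⊕ Bt ⊕ Unit

/-- The top element `⊤₂` of `P₂`. -/
def P2top (i : Pairt → Set ℕ) (φ : ℕ → Pairt) : P2t i φ := Sum.inr (Sum.inr ())

/-- The inclusion of `B` into `P₂`. -/
def P2ofB (i : Pairt → Set ℕ) (φ : ℕ → Pairt) (b : Bt) : P2t i φ := Sum.inr (Sum.inl b)

/-- The strict order `<₁ ∪ <₂ ∪ <₃ ∪ <₄ ∪ <₁;<₃` of `P₂`: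
`(g, n, k) <₁ (g, m, k)` iff `n < m`; `<₂` is `⊏` on `B`; `(g, n, k) <₃ (g(n), k, ⊤)`;
`x <₄ ⊤₂` for `x ≠ ⊤₂`; and `(g, n, k) <₁;<₃ (g(m), k, ⊤)` for `n < m`. -/
def P2lt (i : Pairt → Set ℕ) (φ : ℕ → Pairt) (f : Pairt → NWord → ℕ) :
    P2t i φ → P2t i φ → Prop := fun x y =>
  (∃ (g : Xt i φ) (n m k : ℕ), x = Sum.inl (g, n, k) ∧ y = Sum.inl (g, m, k) ∧ n < m) ∨
  (∃ b c : Bt, x = P2ofB i φ b ∧ y = P2ofB i φ c ∧ Bsq f b c) ∨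
  (∃ (g : Xt i φ) (n k : ℕ), x = Sum.inl (g, n, k) ∧ y = P2ofB i φ (g.1 n, k, (none : Lt))) ∨
  (x ≠ P2top i φ ∧ y = P2top i φ) ∨
  (∃ (g : Xt i φ) (n m k : ℕ), x = Sum.inl (g, n, k) ∧ n < m ∧
    y = P2ofB i φ (g.1 m, k, (none : Lt)))

/-- The order of `P₂`: the reflexive closure of the strict order. -/
def P2le (i : Pairt → Set ℕ) (φ : ℕ → Pairt) (f : Pairt → NWord → ℕ) (x y : P2t i φ) : Prop :=
  x = y ∨ P2lt i φ f x y

/-- The componentwise order on the product poset `P₁ × P₂`. -/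
def prodLe (i : Pairt → Set ℕ) (φ : ℕ → Pairt) (f : Pairt → NWord → ℕ)
    (x y : P1t × P2t i φ) : Prop :=
  P1le f x.1 y.1 ∧ P2le i φ f x.2 y.2

/-- `max B`: the set of maximal elements of the poset `B`. -/
def maxB (f : Pairt → NWord → ℕ) : Set Bt := {b : Bt | ∀ c : Bt, Ble f b c → b = c}

/-- The set `A = ↓{(a, a) : a ∈ max B} ⊆ P₁ × P₂`: the lower set, in the product order,
generated by the diagonal copies of the maximal elements of `B`. -/
def Adiag (i : Pairt → Set ℕ) (φ : ℕ → Pairt) (f : Pairt → NWord → ℕ) :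
    Set (P1t × P2t i φ) :=
  {q : P1t × P2t i φ | ∃ b ∈ maxB f, prodLe i φ f q (P1ofB b, P2ofB i φ b)}

/-! ### The order of `B` -/

lemma Mle_refl (x : Mt) : Mle x x := by
  rcases x with k | w
  · exact le_refl k
  · exact List.prefix_refl w.1

lemma Mle_trans {x y z : Mt} (h : Mle x y) (h' : Mle y z) : Mle x z := by
  rcases x with a | a <;> rcases y with b | b <;> rcases z with c | c <;>
    simp only [Mle] at h h' ⊢
  · exact h.trans h'
  · exact List.IsPrefix.trans h h'

/-- The value of a natural number, or the length of a word. -/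
def Msize : Mt → ℕ
  | Sum.inl k => k
  | Sum.inr w => w.1.length

lemma Msize_le {x y : Mt} (h : Mle x y) : Msize x ≤ Msize y := by
  rcases x with a | a <;> rcases y with b | b <;> simp only [Mle] at h
  · exact h
  · exact List.IsPrefix.length_le h

lemma Msize_lt {x y : Mt} (h : Mle x y) (hne : x ≠ y) : Msize x < Msize y := by
  rcases x with a | a <;> rcases y with b | b <;> simp only [Mle] at h
  · exact lt_of_le_of_ne h fun e => hne (congrArg _ e)
  · refine lt_of_le_of_ne (List.IsPrefix.length_le h) fun e => hne ?_
    exact congrArg _ (Subtype.ext (List.IsPrefix.eq_of_length h e))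

lemma Ble_none_left {f : Pairt → NWord → ℕ} {m n : ℕ} {c : Bt}
    (h : Ble f (m, n, none) c) : c = (m, n, none) := by
  rcases h with h | h
  · exact h.symm
  · simp only [Bsq, sq1, sq2, sq3, sq4, Llt] at h
    grind

lemma Ble_some_right {f : Pairt → NWord → ℕ} {m n : ℕ} {p : Pairt} {y : Mt} {c : Bt}
    (h : Ble f c (m, n, some (p, y))) : ∃ x, c = (m, n, some (p, x)) ∧ Mle x y := by
  rcases h with h | h
  · exact ⟨y, h, Mle_refl y⟩
  · simp only [Bsq, sq1, sq2, sq3, sq4, Llt, Mlt] at h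
    grind

lemma Ble_some_some {f : Pairt → NWord → ℕ} {m n : ℕ} {p : Pairt} {x y : Mt}
    (h : Mle x y) : Ble f (m, n, some (p, x)) (m, n, some (p, y)) := by
  by_cases hxy : x = y
  · exact Or.inl (by rw [hxy])
  · exact Or.inr (Or.inl ⟨m, n, _, _, rfl, rfl, Or.inr ⟨p, x, y, rfl, rfl, h, hxy⟩⟩)

lemma Ble_some_none_iff {f : Pairt → NWord → ℕ} {m n m' n' : ℕ} {p : Pairt} {y : Mt} :
    Ble f (m, n, some (p, y)) (m', n', none) ↔
      (m' = m ∧ n' = n) ∨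
      (∃ w w', y = Sum.inr w ∧ wordLE w w' ∧ m = p.1.1 ∧ m' = f p w' ∧ n' = n + 1) ∨
      (∃ k k', y = Sum.inl k ∧ k ≤ k' ∧ m = p.1.2 ∧ m' = f p (word1 k') ∧ n' = n + 1) ∨
      (∃ k k' s, y = Sum.inl k ∧ k ≤ k' ∧ m = f p s ∧ m' = f p (wordSnoc s k') ∧ n' = n) := by
  constructor
  · rintro (h | h | h | h | h | ⟨z, h, h'⟩ | ⟨z, h, h'⟩ | ⟨z, h, h'⟩)
    · simp at h
    · obtain ⟨a, b, u, v, h1, h2, -⟩ := h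
      simp only [Prod.mk.injEq] at h1 h2
      exact Or.inl ⟨h2.1.trans h1.1.symm, h2.2.1.trans h1.2.1.symm⟩
    · obtain ⟨a, q, w, h1, h2⟩ := h
      simp only [Prod.mk.injEq, Option.some.injEq] at h1 h2
      obtain ⟨rfl, rfl, rfl, rfl⟩ := h1
      exact Or.inr (Or.inl ⟨w, w, rfl, List.prefix_refl _, rfl, h2.1, h2.2.1⟩)
    · obtain ⟨a, k, q, h1, h2⟩ := h
      simp only [Prod.mk.injEq, Option.some.injEq] at h1 h2
      obtain ⟨rfl, rfl, rfl, rfl⟩ := h1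
      exact Or.inr (Or.inr (Or.inl ⟨k, k, rfl, le_rfl, rfl, h2.1, h2.2.1⟩))
    · obtain ⟨a, k, q, s, h1, h2⟩ := h
      simp only [Prod.mk.injEq, Option.some.injEq] at h1 h2
      obtain ⟨rfl, rfl, rfl, rfl⟩ := h1
      exact Or.inr (Or.inr (Or.inr ⟨k, k, s, rfl, le_rfl, rfl, h2.1, h2.2.1⟩))
    · obtain ⟨a, q, w, rfl, h2⟩ := h'
      obtain ⟨x, h1, h3⟩ := Ble_some_right (f := f) (Or.inr (Or.inl h))
      simp only [Prod.mk.injEq, Option.some.injEq] at h1 h2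
      obtain ⟨rfl, rfl, rfl, rfl⟩ := h1
      rcases y with y | y <;> simp only [Mle] at h3
      exact Or.inr (Or.inl ⟨y, w, rfl, h3, rfl, h2.1, h2.2.1⟩)
    · obtain ⟨a, k, q, rfl, h2⟩ := h'
      obtain ⟨x, h1, h3⟩ := Ble_some_right (f := f) (Or.inr (Or.inl h))
      simp only [Prod.mk.injEq, Option.some.injEq] at h1 h2
      obtain ⟨rfl, rfl, rfl, rfl⟩ := h1
      rcases y with y | y <;> simp only [Mle] at h3
      exact Or.inr (Or.inr (Or.inl ⟨y, k, rfl, h3, rfl, h2.1, h2.2.1⟩))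
    · obtain ⟨a, k, q, s, rfl, h2⟩ := h'
      obtain ⟨x, h1, h3⟩ := Ble_some_right (f := f) (Or.inr (Or.inl h))
      simp only [Prod.mk.injEq, Option.some.injEq] at h1 h2
      obtain ⟨rfl, rfl, rfl, rfl⟩ := h1
      rcases y with y | y <;> simp only [Mle] at h3
      exact Or.inr (Or.inr (Or.inr ⟨y, k, s, rfl, h3, rfl, h2.1, h2.2.1⟩))
  · have key : ∀ {m n : ℕ} {x z : Mt} {c : Bt}, Mle x z →
        (sq2 f (m, n, some (p, z)) c ∨ sq3 f (m, n, some (p, z)) c ∨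
          sq4 f (m, n, some (p, z)) c) → Ble f (m, n, some (p, x)) c := by
      intro m n x z c hle h
      by_cases hxz : x = z
      · subst hxz
        exact Or.inr (Or.inr (by tauto))
      · have h1 : sq1 (m, n, some (p, x)) (m, n, some (p, z)) :=
          ⟨m, n, _, _, rfl, rfl, Or.inr ⟨p, x, z, rfl, rfl, hle, hxz⟩⟩
        right
        rcases h with h | h | h
        · exact Or.inr (Or.inr (Or.inr (Or.inr (Or.inl ⟨_, h1, h⟩))))
        · exact Or.inr (Or.inr (Or.inr (Or.inr (Or.inr (Or.inl ⟨_, h1, h⟩)))))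
        · exact Or.inr (Or.inr (Or.inr (Or.inr (Or.inr (Or.inr ⟨_, h1, h⟩)))))
    rintro (⟨rfl, rfl⟩ | ⟨w, w', rfl, h, rfl, rfl, rfl⟩ | ⟨k, k', rfl, h, rfl, rfl, rfl⟩ |
      ⟨k, k', s, rfl, h, rfl, rfl, rfl⟩)
    · exact Or.inr (Or.inl ⟨m', n', _, _, rfl, rfl, Or.inl ⟨by simp, rfl⟩⟩)
    · exact key (z := Sum.inr w') h (Or.inl ⟨_, _, _, rfl, rfl⟩)
    · exact key (z := Sum.inl k') h (Or.inr (Or.inl ⟨_, _, _, rfl, rfl⟩))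
    · exact key (z := Sum.inl k') h (Or.inr (Or.inr ⟨_, _, _, _, rfl, rfl⟩))

lemma Ble_trans_none {f : Pairt → NWord → ℕ} {c d : Bt} {m n : ℕ}
    (h : Ble f c d) (h' : Ble f d (m, n, none)) : Ble f c (m, n, none) := by
  obtain ⟨a, b, _ | ⟨p, y⟩⟩ := d
  · rw [Ble_none_left h']
    exact h
  · obtain ⟨x, rfl, hx⟩ := Ble_some_right h
    rw [Ble_some_none_iff] at h' ⊢
    rcases h' with h' | ⟨w, w', rfl, hw, h'⟩ | ⟨k, k', rfl, hk, h'⟩ | ⟨k, k', s, rfl, hk, h'⟩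
    · exact Or.inl h'
    · rcases x with x | x <;> simp only [Mle] at hx
      exact Or.inr (Or.inl ⟨x, w', rfl, List.IsPrefix.trans hx hw, h'⟩)
    · rcases x with x | x <;> simp only [Mle] at hx
      exact Or.inr (Or.inr (Or.inl ⟨x, k', rfl, hx.trans hk, h'⟩))
    · rcases x with x | x <;> simp only [Mle] at hx
      exact Or.inr (Or.inr (Or.inr ⟨x, k', s, rfl, hx.trans hk, h'⟩))

lemma mem_maxB_iff {f : Pairt → NWord → ℕ} {b : Bt} :
    b ∈ maxB f ↔ ∃ m n, b = (m, n, none) := by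
  constructor
  · intro h
    obtain ⟨m, n, _ | ⟨p, y⟩⟩ := b
    · exact ⟨m, n, rfl⟩
    · exact ⟨m, n, h _ (Ble_some_none_iff.2 (Or.inl ⟨rfl, rfl⟩))⟩
  · rintro ⟨m, n, rfl⟩ c hc
    exact (Ble_none_left hc).symm

/-- The pairs `(m, n)` such that the maximal element `(m, n, ⊤)` lies above `c`. -/
def upB (f : Pairt → NWord → ℕ) (c : Bt) : Set (ℕ × ℕ) :=
  {t | Ble f c (t.1, t.2, none)}

/-- On every level `n`, the set `G` has at most one element in each `i p`. -/
def Thin (i : Pairt → Set ℕ) (G : Set (ℕ × ℕ)) : Prop :=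
  ∀ p n m m', m ∈ i p → m' ∈ i p → (m, n) ∈ G → (m', n) ∈ G → m = m'

lemma thin_upB_none (i : Pairt → Set ℕ) (f : Pairt → NWord → ℕ) (m n : ℕ) :
    Thin i (upB f (m, n, none)) := by
  intro p k a b _ _ ha hb
  have h1 := Ble_none_left ha
  have h2 := Ble_none_left hb
  simp only [Prod.mk.injEq] at h1 h2
  exact h1.1.trans h2.1.symm

lemma IFData.eq_of_mem {i : Pairt → Set ℕ} {f : Pairt → NWord → ℕ} (hif : IFData i f)
    {p q : Pairt} {k : ℕ} (hp : k ∈ i p) (hq : k ∈ i q) : p = q := by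
  by_contra h
  have := hif.disj p q h
  exact Set.notMem_empty k (this ▸ ⟨hp, hq⟩)

lemma IFData.f_inj {i : Pairt → Set ℕ} {f : Pairt → NWord → ℕ} (hif : IFData i f)
    {p q : Pairt} {v w : NWord} (h : f p v = f q w) : p = q ∧ v = w := by
  have hpq : p = q := hif.eq_of_mem (hif.mem p v) (h ▸ hif.mem q w)
  subst hpq
  exact ⟨rfl, hif.finj p h⟩

lemma IFData.snd_ne {i : Pairt → Set ℕ} {f : Pairt → NWord → ℕ} (hif : IFData i f)
    (p : Pairt) (w : NWord) : p.1.2 ≠ f p w :=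
  (hif.gt p _ (hif.mem p w)).ne

lemma wordSnoc_inj {s s' : NWord} {k k' : ℕ} (h : wordSnoc s k = wordSnoc s' k') :
    s = s' ∧ k = k' := by
  have h1 := congrArg Subtype.val h
  simp only [wordSnoc] at h1
  have h2 := List.append_inj' h1 rfl
  exact ⟨Subtype.ext h2.1, by simpa using h2.2⟩

lemma word1_ne_wordSnoc (k k' : ℕ) (s : NWord) : word1 k ≠ wordSnoc s k' := by
  intro h
  have h1 := congrArg (fun w : NWord => w.1.length) h
  simp [word1, wordSnoc] at h1
  exact s.2 h1

lemma wordLE_word1 {w : NWord} {k : ℕ} (h : wordLE w (word1 k)) : w = word1 k := by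
  refine Subtype.ext (List.IsPrefix.eq_of_length_le h ?_)
  exact List.length_pos_of_ne_nil w.2

lemma wordLE_wordSnoc {w s : NWord} {k : ℕ} (h : wordLE w (wordSnoc s k)) :
    w = wordSnoc s k ∨ wordLE w s := by
  rcases List.prefix_concat_iff.1 (show w.1 <+: s.1 ++ [k] from h) with h | h
  · exact Or.inl (Subtype.ext h)
  · exact Or.inr h

/-- A description of the elements `c ∈ B` below almost all maximal elements of a sequence
`(f p (z N), l, ⊤)`. -/
lemma upB_eventually {i : Pairt → Set ℕ} {f : Pairt → NWord → ℕ} (hif : IFData i f)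
    {p q : Pairt} {l m n : ℕ} {x : Mt} {z : ℕ → NWord}
    (hz : ∀ w, ∃ N₀, ∀ N ≥ N₀, z N ≠ w)
    (hG : ∀ N, (f p (z N), l) ∈ upB f (m, n, some (q, x))) :
    q = p ∧ ∃ N₀,
      ((∃ w, x = Sum.inr w ∧ m = p.1.1 ∧ l = n + 1 ∧ ∀ N ≥ N₀, wordLE w (z N)) ∨
      (m = p.1.2 ∧ l = n + 1 ∧ ∀ N ≥ N₀, ∃ k, z N = word1 k) ∨
      (∃ s, m = f p s ∧ l = n ∧ ∀ N ≥ N₀, ∃ k, z N = wordSnoc s k)) := by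
  obtain ⟨N₀, hN₀⟩ : ∃ N₀, ∀ N ≥ N₀, f p (z N) ≠ m := by
    by_cases h : ∃ w, f p w = m
    · obtain ⟨w, rfl⟩ := h
      obtain ⟨N₀, h₀⟩ := hz w
      exact ⟨N₀, fun N hN e => h₀ N hN (hif.finj p e)⟩
    · exact ⟨0, fun N _ e => h ⟨_, e⟩⟩
  have hG' := fun N (hN : N ≥ N₀) =>
    (Ble_some_none_iff.1 (hG N)).resolve_left fun e => hN₀ N hN e.1
  rcases hG' N₀ le_rfl with ⟨w, w', rfl, hw, hm, hf, hl⟩ | ⟨k, k', rfl, hk, hm, hf, hl⟩ |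
    ⟨k, k', s, rfl, hk, hm, hf, hl⟩
  · obtain ⟨rfl, -⟩ := hif.f_inj hf
    refine ⟨rfl, N₀, Or.inl ⟨w, rfl, hm, hl, fun N hN => ?_⟩⟩
    rcases hG' N hN with ⟨v, v', hv, hv', -, hf', -⟩ | ⟨k, k', hk, -⟩ | ⟨k, k', s, hk, -⟩
    · cases hv
      rw [(hif.f_inj hf').2]
      exact hv'
    · cases hk
    · cases hk
  · obtain ⟨rfl, -⟩ := hif.f_inj hf
    refine ⟨rfl, N₀, Or.inr (Or.inl ⟨hm, hl, fun N hN => ?_⟩)⟩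
    rcases hG' N hN with ⟨v, v', hv, -⟩ | ⟨k, k', -, -, -, hf', -⟩ | ⟨k, k', s, -, -, hm', -⟩
    · cases hv
    · exact ⟨k', (hif.f_inj hf').2⟩
    · exact (hif.snd_ne _ _ (hm.symm.trans hm')).elim
  · obtain ⟨rfl, -⟩ := hif.f_inj hf
    refine ⟨rfl, N₀, Or.inr (Or.inr ⟨s, hm, hl, fun N hN => ?_⟩)⟩
    rcases hG' N hN with ⟨v, v', hv, -⟩ | ⟨k, k', -, -, hm', -⟩ | ⟨k, k', s', -, -, hm', hf', -⟩
    · cases hv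
    · exact (hif.snd_ne _ _ (hm'.symm.trans hm)).elim
    · refine ⟨k', ?_⟩
      rw [(hif.f_inj (hm.symm.trans hm')).2]
      exact (hif.f_inj hf').2

/-- If `G` is thin or the set of maximal elements above some element of `B`, and `G` meets the
set of maximal elements above each member of an unbounded chain `(m, n, (y N)_p)`,
then the supremum `(m, n, ⊤)` of the chain belongs to `G`. -/
lemma mem_of_forall_meets_upB {i : Pairt → Set ℕ} {f : Pairt → NWord → ℕ} (hif : IFData i f)
    {G : Set (ℕ × ℕ)} (hG : Thin i G ∨ ∃ c, G = upB f c) {m n : ℕ} {p : Pairt} {x : Mt}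
    {y : ℕ → Mt} (hxy : ∀ N, Mle x (y N)) (hy : ∀ N, N ≤ Msize (y N))
    (hmeet : ∀ N, ∃ t ∈ G, t ∈ upB f (m, n, some (p, y N))) : (m, n) ∈ G := by
  by_contra hmn
  have hmeet' : ∀ N, ∃ m' n', (m', n') ∈ G ∧ _ := fun N => by
    obtain ⟨⟨m', n'⟩, ht, ht'⟩ := hmeet N
    exact ⟨m', n', ht, (Ble_some_none_iff.1 ht').resolve_left
      (by rintro ⟨rfl, rfl⟩; exact hmn ht)⟩
  have key : ∀ (z : ℕ → NWord) (l : ℕ), (∀ w, ∃ N₀, ∀ N ≥ N₀, z N ≠ w) →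
      (∀ N, (f p (z N), l) ∈ G) → ∃ q m' n' x', G = upB f (m', n', some (q, x')) := by
    intro z l hz hzG
    have hnt : ¬ Thin i G := by
      intro hthin
      obtain ⟨N₀, h₀⟩ := hz (z 0)
      exact h₀ N₀ le_rfl (hif.finj p
        (hthin p l _ _ (hif.mem _ _) (hif.mem _ _) (hzG N₀) (hzG 0)))
    obtain ⟨⟨m', n', _ | ⟨q, x'⟩⟩, rfl⟩ := hG.resolve_left hnt
    · exact (hnt (thin_upB_none i f m' n')).elim
    · exact ⟨q, m', n', x', rfl⟩
  rcases x with k₀ | w₀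
  · have hyk : ∀ N, ∃ k, y N = Sum.inl k ∧ N ≤ k := fun N => by
      have h1 := hxy N
      have h2 := hy N
      rcases hN : y N with k | w
      · rw [hN] at h2
        exact ⟨k, rfl, h2⟩
      · rw [hN] at h1
        exact h1.elim
    by_cases hm : m = p.1.2
    · have h1 : ∀ N, ∃ k, N ≤ k ∧ (f p (word1 k), n + 1) ∈ G := fun N => by
        obtain ⟨k, hk, hNk⟩ := hyk N
        obtain ⟨m', n', hG', ⟨w, w', h, -⟩ | ⟨a, a', h, ha, -, rfl, rfl⟩ |
          ⟨a, a', s, h, -, h', -⟩⟩ := hmeet' N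
        · rw [hk] at h; cases h
        · rw [hk] at h; cases h
          exact ⟨a', hNk.trans ha, hG'⟩
        · exact (hif.snd_ne _ _ (hm.symm.trans h')).elim
      choose k hk hkG using h1
      have hz : ∀ w, ∃ N₀, ∀ N ≥ N₀, word1 (k N) ≠ w := by
        intro w
        refine ⟨w.1.head w.2 + 1, fun N hN e => ?_⟩
        subst e
        have := hk N
        simp only [word1, List.head_cons] at hN
        omega
      obtain ⟨q, m', n', x', rfl⟩ := key _ _ hz hkG
      obtain ⟨rfl, N₀, ⟨w, rfl, rfl, hl, hw⟩ | ⟨rfl, hl, hw⟩ | ⟨s, rfl, hl, hw⟩⟩ :=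
        upB_eventually hif hz hkG
      · obtain ⟨N₁, h₁⟩ := hz w
        exact h₁ (max N₀ N₁) (le_max_right _ _)
          (wordLE_word1 (hw (max N₀ N₁) (le_max_left _ _))).symm
      · exact hmn (Ble_some_none_iff.2 (Or.inl ⟨hm, by omega⟩))
      · obtain ⟨k', hk'⟩ := hw N₀ le_rfl
        exact word1_ne_wordSnoc _ _ _ hk'
    · obtain ⟨s, hs⟩ : ∃ s, m = f p s := by
        obtain ⟨k, hk, hNk⟩ := hyk 0
        obtain ⟨m', n', hG', ⟨w, w', h, -⟩ | ⟨a, a', h, ha, h', -⟩ |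
          ⟨a, a', s, h, -, h', -⟩⟩ := hmeet' 0
        · rw [hk] at h; cases h
        · exact (hm h').elim
        · exact ⟨s, h'⟩
      have h1 : ∀ N, ∃ k, N ≤ k ∧ (f p (wordSnoc s k), n) ∈ G := fun N => by
        obtain ⟨k, hk, hNk⟩ := hyk N
        obtain ⟨m', n', hG', ⟨w, w', h, -⟩ | ⟨a, a', h, ha, h', -⟩ |
          ⟨a, a', s', h, ha, h', rfl, rfl⟩⟩ := hmeet' N
        · rw [hk] at h; cases h
        · exact (hm h').elim
        · rw [hk] at h; cases h
          rw [(hif.f_inj (hs.symm.trans h')).2]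
          exact ⟨a', hNk.trans ha, hG'⟩
      choose k hk hkG using h1
      have hz : ∀ w, ∃ N₀, ∀ N ≥ N₀, wordSnoc s (k N) ≠ w := by
        intro w
        by_cases h : ∃ a, wordSnoc s a = w
        · obtain ⟨a, rfl⟩ := h
          refine ⟨a + 1, fun N hN e => ?_⟩
          have := (wordSnoc_inj e).2
          have := hk N
          omega
        · exact ⟨0, fun N _ e => h ⟨_, e⟩⟩
      obtain ⟨q, m', n', x', rfl⟩ := key _ _ hz hkG
      obtain ⟨rfl, N₀, ⟨w, rfl, rfl, hl, hw⟩ | ⟨rfl, hl, hw⟩ | ⟨s', rfl, hl, hw⟩⟩ :=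
        upB_eventually hif hz hkG
      · obtain ⟨N₁, h₁⟩ := hz w
        have h2 := (wordLE_wordSnoc (hw (max N₀ N₁) (le_max_left _ _))).resolve_left
          (h₁ _ (le_max_right _ _)).symm
        exact hmn (Ble_some_none_iff.2 (Or.inr (Or.inl ⟨w, s, rfl, h2, rfl, hs, hl⟩)))
      · obtain ⟨k', hk'⟩ := hw N₀ le_rfl
        exact word1_ne_wordSnoc _ _ _ hk'.symm
      · obtain ⟨k', hk'⟩ := hw N₀ le_rfl
        rw [(wordSnoc_inj hk').1] at hs
        exact hmn (Ble_some_none_iff.2 (Or.inl ⟨hs, hl⟩))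
  · have hyw : ∀ N, ∃ w, y N = Sum.inr w ∧ N ≤ w.1.length := fun N => by
      have h1 := hxy N
      have h2 := hy N
      rcases hN : y N with k | w
      · rw [hN] at h1
        exact h1.elim
      · rw [hN] at h2
        exact ⟨w, rfl, h2⟩
    have h1 : ∀ N, m = p.1.1 ∧ ∃ w, N ≤ w.1.length ∧ (f p w, n + 1) ∈ G := fun N => by
      obtain ⟨w, hw, hNw⟩ := hyw N
      obtain ⟨m', n', hG', ⟨v, v', h, hv, h', rfl, rfl⟩ | ⟨a, a', h, -⟩ |
        ⟨a, a', s, h, -⟩⟩ := hmeet' N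
      · rw [hw] at h; cases h
        exact ⟨h', v', hNw.trans (List.IsPrefix.length_le hv), hG'⟩
      · rw [hw] at h; cases h
      · rw [hw] at h; cases h
    have hm := (h1 0).1
    choose z hzl hzG using fun N => (h1 N).2
    have hz : ∀ w, ∃ N₀, ∀ N ≥ N₀, z N ≠ w := by
      intro w
      refine ⟨w.1.length + 1, fun N hN e => ?_⟩
      subst e
      have := hzl N
      omega
    obtain ⟨q, m', n', x', rfl⟩ := key _ _ hz hzG
    obtain ⟨rfl, N₀, ⟨w, rfl, rfl, hl, hw⟩ | ⟨rfl, hl, hw⟩ | ⟨s, rfl, hl, hw⟩⟩ :=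
      upB_eventually hif hz hzG
    · exact hmn (Ble_some_none_iff.2 (Or.inl ⟨hm, by omega⟩))
    · obtain ⟨k, hk⟩ := hw (max N₀ 2) (le_max_left _ _)
      have h2 := hzl (max N₀ 2)
      rw [hk] at h2
      simp only [word1, List.length_singleton] at h2
      omega
    · obtain ⟨k, hk⟩ := hw (max N₀ (s.1.length + 2)) (le_max_left _ _)
      have h2 := hzl (max N₀ (s.1.length + 2))
      rw [hk] at h2
      simp only [wordSnoc, List.length_append, List.length_singleton] at h2
      omega

/-! ### Extensions of `B` by chains and a top element -/

/-- The common shape of the orders of `P₁` and `P₂`: the elements of `Z` form disjoint chains,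
indexed by `idx` and ranked by `rk`, and the chain element `z` lies below the maximal elements
`tgt z'` of `B` for the later elements `z'` of its chain. -/
structure ChainExt (f : Pairt → NWord → ℕ) {I Z : Type}
    (le : Z ⊕ Bt ⊕ Unit → Z ⊕ Bt ⊕ Unit → Prop) (idx : Z → I) (rk : Z → ℕ)
    (tgt : Z → ℕ × ℕ) : Prop where
  chain_inj : ∀ z z', idx z = idx z' → rk z = rk z' → z = z'
  inl_iff : ∀ z v, le (Sum.inl z) v ↔ v = Sum.inr (Sum.inr ()) ∨
    ∃ z', idx z' = idx z ∧ rk z ≤ rk z' ∧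
      (v = Sum.inl z' ∨ v = Sum.inr (Sum.inl ((tgt z').1, (tgt z').2, none)))
  ofB_iff : ∀ c v, le (Sum.inr (Sum.inl c)) v ↔ v = Sum.inr (Sum.inr ()) ∨
    ∃ c', v = Sum.inr (Sum.inl c') ∧ Ble f c c'
  top_iff : ∀ v, le (Sum.inr (Sum.inr ())) v ↔ v = Sum.inr (Sum.inr ())

/-- The pairs `(m, n)` such that the element `(m, n, ⊤)` of `B` lies above `x`. -/
def upMax {Z : Type} (le : Z ⊕ Bt ⊕ Unit → Z ⊕ Bt ⊕ Unit → Prop) (x : Z ⊕ Bt ⊕ Unit) :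
    Set (ℕ × ℕ) :=
  {t | le x (Sum.inr (Sum.inl (t.1, t.2, none)))}

namespace ChainExt

variable {f : Pairt → NWord → ℕ} {I Z : Type} {le : Z ⊕ Bt ⊕ Unit → Z ⊕ Bt ⊕ Unit → Prop}
  {idx : Z → I} {rk : Z → ℕ} {tgt : Z → ℕ × ℕ}

lemma upMax_top (h : ChainExt f le idx rk tgt) : upMax le (Sum.inr (Sum.inr ())) = ∅ := by
  ext t
  simp [upMax, h.top_iff]

lemma upMax_ofB (h : ChainExt f le idx rk tgt) (c : Bt) :
    upMax le (Sum.inr (Sum.inl c)) = upB f c := by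
  ext t
  simp [upMax, h.ofB_iff, upB]

lemma mem_upMax_inl (h : ChainExt f le idx rk tgt) {z : Z} {t : ℕ × ℕ} :
    t ∈ upMax le (Sum.inl z) ↔ ∃ z', idx z' = idx z ∧ rk z ≤ rk z' ∧ t = tgt z' := by
  simp [upMax, h.inl_iff, Prod.ext_iff]

lemma upMax_anti (h : ChainExt f le idx rk tgt) {x y : Z ⊕ Bt ⊕ Unit} (hxy : le x y) :
    upMax le y ⊆ upMax le x := by
  intro t ht
  rcases x with z | c | _
  · rcases (h.inl_iff z y).1 hxy with rfl | ⟨z', hi, hr, rfl | rfl⟩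
    · simp [h.upMax_top] at ht
    · obtain ⟨z'', hi', hr', rfl⟩ := h.mem_upMax_inl.1 ht
      exact h.mem_upMax_inl.2 ⟨z'', hi'.trans hi, hr.trans hr', rfl⟩
    · rw [h.upMax_ofB] at ht
      have h1 := Ble_none_left ht
      simp only [Prod.mk.injEq] at h1
      exact h.mem_upMax_inl.2 ⟨z', hi, hr, Prod.ext h1.1 h1.2.1⟩
  · rcases (h.ofB_iff c y).1 hxy with rfl | ⟨c', rfl, hc⟩
    · simp [h.upMax_top] at ht
    · rw [h.upMax_ofB] at ht ⊢
      exact Ble_trans_none hc ht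
  · rw [(h.top_iff y).1 hxy] at ht
    exact ht

lemma le_ofB_refl (h : ChainExt f le idx rk tgt) (c : Bt) :
    le (Sum.inr (Sum.inl c)) (Sum.inr (Sum.inl c)) :=
  (h.ofB_iff c _).2 (Or.inr ⟨c, rfl, Or.inl rfl⟩)

/-- The elements `x` such that `upMax le x` meets `G` are closed under directed suprema, when `G`
meets no unbounded part of the targets of a chain. -/
lemma meets_of_isLub (h : ChainExt f le idx rk tgt) {i : Pairt → Set ℕ} (hif : IFData i f)
    {G : Set (ℕ × ℕ)} (hG : Thin i G ∨ ∃ c, G = upB f c)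
    (hchain : ∀ ι, ¬ ∀ N, ∃ z, idx z = ι ∧ N ≤ rk z ∧ tgt z ∈ G)
    {S : Set (Z ⊕ Bt ⊕ Unit)} (hS : DirectedOn' le S) {u : Z ⊕ Bt ⊕ Unit} (hu : IsLub' le S u)
    (hmeet : ∀ s ∈ S, ∃ t ∈ G, t ∈ upMax le s) : ∃ t ∈ G, t ∈ upMax le u := by
  by_cases hmax : ∃ s ∈ S, ∀ s' ∈ S, le s' s
  · obtain ⟨s, hs, hs'⟩ := hmax
    obtain ⟨t, htG, hts⟩ := hmeet s hs
    exact ⟨t, htG, h.upMax_anti (hu.2 s hs') hts⟩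
  have hstep : ∀ s ∈ S, ∃ z ∈ S, le s z ∧ z ≠ s := by
    intro s hs
    by_contra hcon
    push Not at hcon
    refine hmax ⟨s, hs, fun s' hs' => ?_⟩
    obtain ⟨z, hz, hsz, hs'z⟩ := hS.2 s hs s' hs'
    rwa [hcon z hz hsz] at hs'z
  have htop : Sum.inr (Sum.inr ()) ∉ S := by
    intro ht
    obtain ⟨t, -, ht⟩ := hmeet _ ht
    simp [h.upMax_top] at ht
  have hnone : ∀ m n, Sum.inr (Sum.inl (m, n, none)) ∉ S := by
    intro m n hmn
    obtain ⟨z, hz, hle, hne⟩ := hstep _ hmn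
    rcases (h.ofB_iff _ z).1 hle with rfl | ⟨c, rfl, hc⟩
    · exact htop hz
    · exact hne (by rw [Ble_none_left hc])
  by_cases hB : ∃ c, Sum.inr (Sum.inl c) ∈ S
  · obtain ⟨⟨m, n, _ | ⟨p, x₀⟩⟩, hc⟩ := hB
    · exact (hnone m n hc).elim
    have habove : ∀ x z, z ∈ S → le (Sum.inr (Sum.inl (m, n, some (p, x)))) z →
        ∃ x', z = Sum.inr (Sum.inl (m, n, some (p, x'))) ∧ Mle x x' := by
      intro x z hz hle
      rcases (h.ofB_iff _ z).1 hle with rfl | ⟨⟨a, b, _ | ⟨q, x'⟩⟩, rfl, hc⟩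
      · exact (htop hz).elim
      · exact (hnone _ _ hz).elim
      · obtain ⟨x'', h1, h2⟩ := Ble_some_right hc
        simp only [Prod.mk.injEq, Option.some.injEq] at h1
        obtain ⟨rfl, rfl, rfl, rfl⟩ := h1
        exact ⟨x', rfl, h2⟩
    have hunb : ∀ N, ∃ x, Mle x₀ x ∧ N ≤ Msize x ∧
        Sum.inr (Sum.inl (m, n, some (p, x))) ∈ S := by
      intro N
      induction N with
      | zero => exact ⟨x₀, Mle_refl _, Nat.zero_le _, hc⟩
      | succ N ih =>
        obtain ⟨x, hx, hN, hxS⟩ := ih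
        obtain ⟨z, hz, hle, hne⟩ := hstep _ hxS
        obtain ⟨x', rfl, hx'⟩ := habove x z hz hle
        refine ⟨x', Mle_trans hx hx', ?_, hz⟩
        exact lt_of_le_of_lt hN (Msize_lt hx' fun e => hne (by rw [e]))
    choose y hxy hy hyS using hunb
    refine ⟨(m, n), ?_, ?_⟩
    · refine mem_of_forall_meets_upB hif hG hxy hy (p := p) fun N => ?_
      rw [← h.upMax_ofB]
      exact hmeet _ (hyS N)
    · refine hu.2 _ fun s hs => ?_
      obtain ⟨z, hz, hsz, hcz⟩ := hS.2 s hs _ hc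
      obtain ⟨x', rfl, -⟩ := habove x₀ z hz hcz
      have h1 : (m, n) ∈ upMax le (Sum.inr (Sum.inl (m, n, some (p, x')))) := by
        rw [h.upMax_ofB]
        exact Ble_some_none_iff.2 (Or.inl ⟨rfl, rfl⟩)
      exact h.upMax_anti hsz h1
  · obtain ⟨s₀, hs₀⟩ := hS.1
    have hinl : ∀ s ∈ S, ∃ z, s = Sum.inl z := by
      rintro (z | c | _) hs
      · exact ⟨z, rfl⟩
      · exact (hB ⟨c, hs⟩).elim
      · exact (htop hs).elim
    obtain ⟨z₀, rfl⟩ := hinl s₀ hs₀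
    refine (hchain (idx z₀) fun N => ?_).elim
    have hunb : ∃ z, Sum.inl z ∈ S ∧ idx z = idx z₀ ∧ N ≤ rk z := by
      induction N with
      | zero => exact ⟨z₀, hs₀, rfl, Nat.zero_le _⟩
      | succ N ih =>
        obtain ⟨z, hz, hi, hN⟩ := ih
        obtain ⟨w, hw, hle, hne⟩ := hstep _ hz
        obtain ⟨z', rfl⟩ := hinl w hw
        rcases (h.inl_iff z _).1 hle with h1 | ⟨z'', hi', hr, h1 | h1⟩
        · cases h1
        · cases h1
          refine ⟨z', hw, hi'.trans hi, lt_of_le_of_lt hN (lt_of_le_of_ne hr fun e => ?_)⟩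
          exact hne (by rw [h.chain_inj _ _ hi' e.symm])
        · cases h1
    obtain ⟨z, hz, hi, hN⟩ := hunb
    obtain ⟨t, htG, ht⟩ := hmeet _ hz
    obtain ⟨z', hi', hr, rfl⟩ := h.mem_upMax_inl.1 ht
    exact ⟨z', hi'.trans hi, hN.trans hr, htG⟩

/-- The supremum of an unbounded chain `(m, n, (y N)_p)` is `(m, n, ⊤)`. -/
lemma le_of_forall_chain_le (h : ChainExt f le idx rk tgt) {i : Pairt → Set ℕ} (hif : IFData i f)
    {m n : ℕ} {p : Pairt} {x : Mt} {y : ℕ → Mt} (hxy : ∀ N, Mle x (y N))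
    (hy : ∀ N, N ≤ Msize (y N)) {v : Z ⊕ Bt ⊕ Unit}
    (hv : ∀ N, le (Sum.inr (Sum.inl (m, n, some (p, y N)))) v) :
    le (Sum.inr (Sum.inl (m, n, none))) v := by
  rcases v with z | ⟨a, b, _ | ⟨q, x'⟩⟩ | _
  · simpa using (h.ofB_iff _ _).1 (hv 0)
  · have h1 : (m, n) ∈ upB f (a, b, none) :=
      mem_of_forall_meets_upB hif (Or.inr ⟨_, rfl⟩) hxy hy fun N =>
        ⟨(a, b), Or.inl rfl, by rw [← h.upMax_ofB]; exact hv N⟩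
    rw [Ble_none_left h1]
    exact h.le_ofB_refl _
  · rcases (h.ofB_iff _ _).1 (hv (Msize x' + 1)) with h1 | ⟨c, h1, hc⟩
    · cases h1
    · cases h1
      obtain ⟨w, h2, h3⟩ := Ble_some_right hc
      simp only [Prod.mk.injEq, Option.some.injEq] at h2
      rw [← h2.2.2.2] at h3
      have := Msize_le h3
      have := hy (Msize x' + 1)
      omega
  · exact (h.ofB_iff _ _).2 (Or.inl rfl)

end ChainExt

lemma chainExt_P1 (f : Pairt → NWord → ℕ) :
    ChainExt f (P1le f) (fun z : (ℕ → ℕ) × ℕ => z.1) (fun z => z.2)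
      (fun z => (z.1 z.2, z.2)) where
  chain_inj := fun z z' h h' => Prod.ext h h'
  inl_iff := by
    rintro ⟨g, n⟩ v
    simp only [P1le, P1lt, P1ofB, P1top]
    constructor
    · rintro (rfl | ⟨g', a, b, h1, rfl, hab⟩ | ⟨b, c, h1, -⟩ | ⟨g', a, h1, rfl⟩ | ⟨-, rfl⟩ |
        ⟨g', a, b, h1, hab, rfl⟩)
      · exact Or.inr ⟨(g, n), rfl, le_rfl, Or.inl rfl⟩
      · cases h1
        exact Or.inr ⟨(g, b), rfl, hab.le, Or.inl rfl⟩
      · cases h1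
      · cases h1
        exact Or.inr ⟨(g, n), rfl, le_rfl, Or.inr rfl⟩
      · exact Or.inl rfl
      · cases h1
        exact Or.inr ⟨(g, b), rfl, hab.le, Or.inr rfl⟩
    · rintro (rfl | ⟨⟨g', b⟩, rfl, hab, rfl | rfl⟩)
      · exact Or.inr (Or.inr (Or.inr (Or.inr (Or.inl ⟨by simp, rfl⟩))))
      · rcases Nat.eq_or_lt_of_le hab with h | h
        · exact Or.inl (by rw [show n = b from h])
        · exact Or.inr (Or.inl ⟨_, _, _, rfl, rfl, h⟩)
      · rcases Nat.eq_or_lt_of_le hab with h | h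
        · exact Or.inr (Or.inr (Or.inr (Or.inl ⟨_, _, rfl, by rw [show n = b from h]⟩)))
        · exact Or.inr (Or.inr (Or.inr (Or.inr (Or.inr ⟨_, _, _, rfl, h, rfl⟩))))
  ofB_iff := by
    intro c v
    simp only [P1le, P1lt, P1ofB, P1top, Ble]
    constructor
    · rintro (rfl | ⟨_, _, _, h1, -⟩ | ⟨b, c', h1, rfl, h2⟩ | ⟨_, _, h1, -⟩ | ⟨-, rfl⟩ |
        ⟨_, _, _, h1, -⟩)
      · exact Or.inr ⟨c, rfl, Or.inl rfl⟩
      · cases h1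
      · cases h1
        exact Or.inr ⟨c', rfl, Or.inr h2⟩
      · cases h1
      · exact Or.inl rfl
      · cases h1
    · rintro (rfl | ⟨c', rfl, rfl | h2⟩)
      · exact Or.inr (Or.inr (Or.inr (Or.inr (Or.inl ⟨by simp, rfl⟩))))
      · exact Or.inl rfl
      · exact Or.inr (Or.inr (Or.inl ⟨_, _, rfl, rfl, h2⟩))
  top_iff := by
    intro v
    simp [P1le, P1lt, P1ofB, P1top, eq_comm]

lemma chainExt_P2 (i : Pairt → Set ℕ) (φ : ℕ → Pairt) (f : Pairt → NWord → ℕ) :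
    ChainExt f (P2le i φ f) (fun z : Xt i φ × ℕ × ℕ => (z.1, z.2.2)) (fun z => z.2.1)
      (fun z => (z.1.1 z.2.1, z.2.2)) where
  chain_inj := by
    rintro ⟨g, n, k⟩ ⟨g', n', k'⟩ h h'
    simp only [Prod.mk.injEq] at h h' ⊢
    exact ⟨h.1, h', h.2⟩
  inl_iff := by
    rintro ⟨g, n, k⟩ v
    simp only [P2le, P2lt, P2ofB, P2top]
    constructor
    · rintro (rfl | ⟨g', a, b, k', h1, rfl, hab⟩ | ⟨b, c, h1, -⟩ | ⟨g', a, k', h1, rfl⟩ |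
        ⟨-, rfl⟩ | ⟨g', a, b, k', h1, hab, rfl⟩)
      · exact Or.inr ⟨(g, n, k), rfl, le_rfl, Or.inl rfl⟩
      · cases h1
        exact Or.inr ⟨(g, b, k), rfl, hab.le, Or.inl rfl⟩
      · cases h1
      · cases h1
        exact Or.inr ⟨(g, n, k), rfl, le_rfl, Or.inr rfl⟩
      · exact Or.inl rfl
      · cases h1
        exact Or.inr ⟨(g, b, k), rfl, hab.le, Or.inr rfl⟩
    · rintro (rfl | ⟨⟨g', b, k'⟩, h1, hab, h2⟩)
      · exact Or.inr (Or.inr (Or.inr (Or.inr (Or.inl ⟨by simp, rfl⟩))))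
      · cases h1
        rcases h2 with rfl | rfl
        · rcases Nat.eq_or_lt_of_le hab with h | h
          · exact Or.inl (by rw [show n = b from h])
          · exact Or.inr (Or.inl ⟨_, _, _, _, rfl, rfl, h⟩)
        · rcases Nat.eq_or_lt_of_le hab with h | h
          · exact Or.inr (Or.inr (Or.inr (Or.inl ⟨_, _, _, rfl, by rw [show n = b from h]⟩)))
          · exact Or.inr (Or.inr (Or.inr (Or.inr (Or.inr ⟨_, _, _, _, rfl, h, rfl⟩))))
  ofB_iff := by
    intro c v
    simp only [P2le, P2lt, P2ofB, P2top, Ble]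
    constructor
    · rintro (rfl | ⟨_, _, _, _, h1, -⟩ | ⟨b, c', h1, rfl, h2⟩ | ⟨_, _, _, h1, -⟩ | ⟨-, rfl⟩ |
        ⟨_, _, _, _, h1, -⟩)
      · exact Or.inr ⟨c, rfl, Or.inl rfl⟩
      · cases h1
      · cases h1
        exact Or.inr ⟨c', rfl, Or.inr h2⟩
      · cases h1
      · exact Or.inl rfl
      · cases h1
    · rintro (rfl | ⟨c', rfl, rfl | h2⟩)
      · exact Or.inr (Or.inr (Or.inr (Or.inr (Or.inl ⟨by simp, rfl⟩))))
      · exact Or.inl rfl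
      · exact Or.inr (Or.inr (Or.inl ⟨_, _, rfl, rfl, h2⟩))
  top_iff := by
    intro v
    simp [P2le, P2lt, P2ofB, P2top, eq_comm]

/-! ### Closedness of the diagonal -/

section Closed

variable {i : Pairt → Set ℕ} {f : Pairt → NWord → ℕ} {φ : ℕ → Pairt}

lemma mem_Adiag_iff {q : P1t × P2t i φ} :
    q ∈ Adiag i φ f ↔ ∃ t, t ∈ upMax (P1le f) q.1 ∧ t ∈ upMax (P2le i φ f) q.2 := by
  constructor
  · rintro ⟨b, hb, h1, h2⟩
    obtain ⟨m, n, rfl⟩ := mem_maxB_iff.1 hb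
    exact ⟨(m, n), h1, h2⟩
  · rintro ⟨t, h1, h2⟩
    exact ⟨_, mem_maxB_iff.2 ⟨t.1, t.2, rfl⟩, h1, h2⟩

lemma thin_or_upB_P1 (d : P1t) :
    Thin i (upMax (P1le f) d) ∨ ∃ c, upMax (P1le f) d = upB f c := by
  rcases d with z | c | _
  · left
    intro p n m m' _ _ h h'
    obtain ⟨z₁, hi, -, h1⟩ := (chainExt_P1 f).mem_upMax_inl.1 h
    obtain ⟨z₂, hi', -, h2⟩ := (chainExt_P1 f).mem_upMax_inl.1 h'
    simp only [Prod.mk.injEq] at h1 h2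
    rw [h1.1, h2.1, hi, hi', ← h1.2, ← h2.2]
  · exact Or.inr ⟨c, (chainExt_P1 f).upMax_ofB c⟩
  · left
    intro p n m m' _ _ h
    rw [(chainExt_P1 f).upMax_top] at h
    exact h.elim

lemma thin_or_upB_P2 (hif : IFData i f) (hφ : Function.Injective φ) (d : P2t i φ) :
    Thin i (upMax (P2le i φ f) d) ∨ ∃ c, upMax (P2le i φ f) d = upB f c := by
  rcases d with z | c | _
  · left
    intro p n m m' hm hm' h h'
    obtain ⟨z₁, hi, -, h1⟩ := (chainExt_P2 i φ f).mem_upMax_inl.1 h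
    obtain ⟨z₂, hi', -, h2⟩ := (chainExt_P2 i φ f).mem_upMax_inl.1 h'
    simp only [Prod.mk.injEq] at h1 h2 hi hi'
    have e1 : p = φ z₁.2.1 := hif.eq_of_mem hm (h1.1 ▸ z₁.1.2 _)
    have e2 : p = φ z₂.2.1 := hif.eq_of_mem hm' (h2.1 ▸ z₂.1.2 _)
    rw [h1.1, h2.1, hi.1, hi'.1, hφ (e1.symm.trans e2)]
  · exact Or.inr ⟨c, (chainExt_P2 i φ f).upMax_ofB c⟩
  · left
    intro p n m m' _ _ h
    rw [(chainExt_P2 i φ f).upMax_top] at h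
    exact h.elim

lemma upB_level_le {c : Bt} {t : ℕ × ℕ} (h : t ∈ upB f c) : t.2 ≤ c.2.1 + 1 := by
  obtain ⟨m, n, _ | ⟨p, y⟩⟩ := c
  · have h1 := Ble_none_left h
    simp only [Prod.mk.injEq] at h1
    have := h1.2.1
    dsimp only
    omega
  · have h1 := Ble_some_none_iff.1 h
    dsimp only
    grind

lemma not_chain_P1 (d : P2t i φ) (g : ℕ → ℕ) :
    ¬ ∀ N, ∃ z : (ℕ → ℕ) × ℕ, z.1 = g ∧ N ≤ z.2 ∧ (z.1 z.2, z.2) ∈ upMax (P2le i φ f) d := by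
  intro hN
  obtain ⟨M, hM⟩ : ∃ M, ∀ t ∈ upMax (P2le i φ f) d, t.2 ≤ M := by
    rcases d with z | c | _
    · refine ⟨z.2.2, fun t ht => ?_⟩
      obtain ⟨z', hi, -, rfl⟩ := (chainExt_P2 i φ f).mem_upMax_inl.1 ht
      exact (congrArg Prod.snd hi).le
    · refine ⟨c.2.1 + 1, fun t ht => ?_⟩
      rw [(chainExt_P2 i φ f).upMax_ofB] at ht
      exact upB_level_le ht
    · exact ⟨0, fun t ht => by rw [(chainExt_P2 i φ f).upMax_top] at ht; exact ht.elim⟩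
  obtain ⟨z, -, h1, h2⟩ := hN (M + 1)
  have := hM _ h2
  dsimp only at this
  omega

lemma not_chain_P2 (hif : IFData i f) (hφ : Function.Injective φ) (d : P1t)
    (ι : Xt i φ × ℕ) :
    ¬ ∀ N, ∃ z : Xt i φ × ℕ × ℕ, (z.1, z.2.2) = ι ∧ N ≤ z.2.1 ∧
      (z.1.1 z.2.1, z.2.2) ∈ upMax (P1le f) d := by
  obtain ⟨g, k⟩ := ι
  intro hN
  have hN' : ∀ N, ∃ j, N ≤ j ∧ (g.1 j, k) ∈ upMax (P1le f) d := fun N => by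
    obtain ⟨⟨g', j, k'⟩, h1, h2, h3⟩ := hN N
    cases h1
    exact ⟨j, h2, h3⟩
  have hval : ∀ a : ℕ, ∃ N, ∀ j ≥ N, g.1 j ≠ a := by
    intro a
    by_cases ha : ∃ j, g.1 j = a
    · obtain ⟨j, rfl⟩ := ha
      refine ⟨j + 1, fun j' hj' e => ?_⟩
      have := hφ (hif.eq_of_mem (g.2 j') (e ▸ g.2 j))
      omega
    · exact ⟨0, fun j _ e => ha ⟨j, e⟩⟩
  have hidx : ∀ p : Pairt, ∃ N, ∀ j ≥ N, g.1 j ∉ i p := by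
    intro p
    by_cases hp : ∃ j, φ j = p
    · obtain ⟨j, rfl⟩ := hp
      refine ⟨j + 1, fun j' hj' e => ?_⟩
      have := hφ (hif.eq_of_mem (g.2 j') e)
      omega
    · exact ⟨0, fun j _ e => hp ⟨j, hif.eq_of_mem (g.2 j) e⟩⟩
  rcases d with z | ⟨m, n, o⟩ | _
  · obtain ⟨N, h0⟩ := hval (z.1 k)
    obtain ⟨j, hj, h1⟩ := hN' N
    obtain ⟨z', hi, -, h2⟩ := (chainExt_P1 f).mem_upMax_inl.1 h1
    simp only [Prod.mk.injEq] at h2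
    exact h0 j hj (by rw [h2.1, hi, ← h2.2])
  · obtain ⟨N, h0⟩ := hval m
    rcases o with _ | ⟨p, y⟩
    · obtain ⟨j, hj, h1⟩ := hN' N
      rw [(chainExt_P1 f).upMax_ofB] at h1
      have h2 := Ble_none_left h1
      simp only [Prod.mk.injEq] at h2
      exact h0 j hj h2.1
    · obtain ⟨N', h0'⟩ := hidx p
      obtain ⟨j, hj, h1⟩ := hN' (max N N')
      rw [(chainExt_P1 f).upMax_ofB] at h1
      have hne := h0 j (le_of_max_le_left hj)
      have hnm := h0' j (le_of_max_le_right hj)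
      rcases Ble_some_none_iff.1 h1 with h | ⟨w, w', -, -, -, h, -⟩ | ⟨a, a', -, -, -, h, -⟩ |
        ⟨a, a', s, -, -, -, h, -⟩
      · exact hne h.1
      all_goals exact hnm (by dsimp only at h; rw [h]; exact hif.mem _ _)
  · obtain ⟨j, -, h1⟩ := hN' 0
    rw [(chainExt_P1 f).upMax_top] at h1
    exact h1

lemma prodLe_refl (q : P1t × P2t i φ) : prodLe i φ f q q :=
  ⟨Or.inl rfl, Or.inl rfl⟩

lemma Adiag_scottClosed (hif : IFData i f) (hφ : Function.Injective φ) :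
    ScottClosed' (prodLe i φ f) (Adiag i φ f) := by
  constructor
  · intro x y hxy hy
    obtain ⟨t, h1, h2⟩ := mem_Adiag_iff.1 hy
    exact mem_Adiag_iff.2
      ⟨t, (chainExt_P1 f).upMax_anti hxy.1 h1, (chainExt_P2 i φ f).upMax_anti hxy.2 h2⟩
  · rintro D ⟨u₁, u₂⟩ hDA hD hu
    have hdir₁ : DirectedOn' (P1le f) (Prod.fst '' D) := by
      refine ⟨hD.1.image _, ?_⟩
      rintro _ ⟨x, hx, rfl⟩ _ ⟨y, hy, rfl⟩
      obtain ⟨z, hz, h1, h2⟩ := hD.2 x hx y hy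
      exact ⟨z.1, ⟨z, hz, rfl⟩, h1.1, h2.1⟩
    have hdir₂ : DirectedOn' (P2le i φ f) (Prod.snd '' D) := by
      refine ⟨hD.1.image _, ?_⟩
      rintro _ ⟨x, hx, rfl⟩ _ ⟨y, hy, rfl⟩
      obtain ⟨z, hz, h1, h2⟩ := hD.2 x hx y hy
      exact ⟨z.2, ⟨z, hz, rfl⟩, h1.2, h2.2⟩
    have hlub₁ : IsLub' (P1le f) (Prod.fst '' D) u₁ := by
      constructor
      · rintro _ ⟨x, hx, rfl⟩
        exact (hu.1 x hx).1
      · intro v hv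
        exact (hu.2 (v, u₂) fun x hx => ⟨hv _ ⟨x, hx, rfl⟩, (hu.1 x hx).2⟩).1
    have hlub₂ : IsLub' (P2le i φ f) (Prod.snd '' D) u₂ := by
      constructor
      · rintro _ ⟨x, hx, rfl⟩
        exact (hu.1 x hx).2
      · intro v hv
        exact (hu.2 (u₁, v) fun x hx => ⟨(hu.1 x hx).1, hv _ ⟨x, hx, rfl⟩⟩).2
    have hmeet : ∀ x ∈ D, ∀ y ∈ D, ∃ t ∈ upMax (P1le f) x.1, t ∈ upMax (P2le i φ f) y.2 := by
      intro x hx y hy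
      obtain ⟨z, hz, h1, h2⟩ := hD.2 x hx y hy
      obtain ⟨t, ht1, ht2⟩ := mem_Adiag_iff.1 (hDA hz)
      exact ⟨t, (chainExt_P1 f).upMax_anti h1.1 ht1, (chainExt_P2 i φ f).upMax_anti h2.2 ht2⟩
    obtain ⟨t, h2, h1⟩ := (chainExt_P1 f).meets_of_isLub hif
      (thin_or_upB_P2 hif hφ u₂) (not_chain_P1 u₂) hdir₁ hlub₁ (by
        rintro _ ⟨x, hx, rfl⟩
        obtain ⟨t, ht1, ht2⟩ := (chainExt_P2 i φ f).meets_of_isLub hif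
          (thin_or_upB_P1 x.1) (not_chain_P2 hif hφ x.1) hdir₂ hlub₂ (by
            rintro _ ⟨y, hy, rfl⟩
            exact hmeet x hx y hy)
        exact ⟨t, ht2, ht1⟩)
    exact mem_Adiag_iff.2 ⟨t, h1, h2⟩

end Closed

/-! ### Irreducibility of the diagonal -/

section Irreducible

variable {i : Pairt → Set ℕ} {f : Pairt → NWord → ℕ} {φ : ℕ → Pairt}

/-- The diagonal copy of `b ∈ B` in `P₁ × P₂`. -/
def diagPt (i : Pairt → Set ℕ) (φ : ℕ → Pairt) (b : Bt) : P1t × P2t i φ :=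
  (P1ofB b, P2ofB i φ b)

lemma prodLe_diagPt {b c : Bt} (h : Ble f b c) :
    prodLe i φ f (diagPt i φ b) (diagPt i φ c) :=
  ⟨((chainExt_P1 f).ofB_iff _ _).2 (Or.inr ⟨c, rfl, h⟩),
    ((chainExt_P2 i φ f).ofB_iff _ _).2 (Or.inr ⟨c, rfl, h⟩)⟩

lemma diagPt_mem_Adiag (m n : ℕ) : diagPt i φ (m, n, none) ∈ Adiag i φ f :=
  ⟨_, mem_maxB_iff.2 ⟨m, n, rfl⟩, prodLe_refl _⟩

/-- The complement of a Scott closed set that contains a maximal diagonal point contains a member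
of every unbounded chain below it. -/
lemma exists_chain_notMem (hif : IFData i f) {C : Set (P1t × P2t i φ)}
    (hC : ScottClosed' (prodLe i φ f) C) {m n : ℕ} (hmn : diagPt i φ (m, n, none) ∉ C)
    (p : Pairt) {y : ℕ → Mt} (hmono : ∀ N N', N ≤ N' → Mle (y N) (y N'))
    (hy : ∀ N, N ≤ Msize (y N)) : ∃ N, diagPt i φ (m, n, some (p, y N)) ∉ C := by
  by_contra hcon
  push Not at hcon
  refine hmn (hC.2 (Set.range fun N => diagPt i φ (m, n, some (p, y N))) _ ?_ ⟨?_, ?_⟩ ⟨?_, ?_⟩)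
  · rintro _ ⟨N, rfl⟩
    exact hcon N
  · exact Set.range_nonempty _
  · rintro _ ⟨N, rfl⟩ _ ⟨N', rfl⟩
    exact ⟨_, ⟨max N N', rfl⟩, prodLe_diagPt (Ble_some_some (hmono _ _ (le_max_left _ _))),
      prodLe_diagPt (Ble_some_some (hmono _ _ (le_max_right _ _)))⟩
  · rintro _ ⟨N, rfl⟩
    exact prodLe_diagPt (Ble_some_none_iff.2 (Or.inl ⟨rfl, rfl⟩))
  · intro v hv
    exact ⟨(chainExt_P1 f).le_of_forall_chain_le hif (fun N => hmono 0 N (Nat.zero_le N)) hy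
        fun N => (hv _ ⟨N, rfl⟩).1,
      (chainExt_P2 i φ f).le_of_forall_chain_le hif (fun N => hmono 0 N (Nat.zero_le N)) hy
        fun N => (hv _ ⟨N, rfl⟩).2⟩

lemma exists_nat_notMem (hif : IFData i f) {C : Set (P1t × P2t i φ)}
    (hC : ScottClosed' (prodLe i φ f) C) {m n : ℕ} (hmn : diagPt i φ (m, n, none) ∉ C)
    (p : Pairt) : ∃ k, diagPt i φ (m, n, some (p, Sum.inl k)) ∉ C :=
  exists_chain_notMem hif hC hmn p (y := Sum.inl) (fun _ _ h => h) fun _ => le_rfl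

lemma notMem_of_Ble {C : Set (P1t × P2t i φ)} (hC : ScottClosed' (prodLe i φ f) C) {b c : Bt}
    (hb : diagPt i φ b ∉ C) (hbc : Ble f b c) : diagPt i φ c ∉ C :=
  fun hc => hb (hC.1 _ _ (prodLe_diagPt hbc) hc)

lemma exists_word1_notMem (hif : IFData i f) {C : Set (P1t × P2t i φ)}
    (hC : ScottClosed' (prodLe i φ f) C) {n : ℕ} (p : Pairt)
    (hmn : diagPt i φ (p.1.2, n, none) ∉ C) :
    ∃ k, diagPt i φ (f p (word1 k), n + 1, none) ∉ C := by
  obtain ⟨k, hk⟩ := exists_nat_notMem hif hC hmn p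
  exact ⟨k, notMem_of_Ble hC hk
    (Ble_some_none_iff.2 (Or.inr (Or.inr (Or.inl ⟨k, k, rfl, le_rfl, rfl, rfl, rfl⟩))))⟩

lemma exists_wordSnoc_notMem (hif : IFData i f) {C : Set (P1t × P2t i φ)}
    (hC : ScottClosed' (prodLe i φ f) C) {n : ℕ} (p : Pairt) (s : NWord)
    (hmn : diagPt i φ (f p s, n, none) ∉ C) :
    ∃ k, diagPt i φ (f p (wordSnoc s k), n, none) ∉ C := by
  obtain ⟨k, hk⟩ := exists_nat_notMem hif hC hmn p
  exact ⟨k, notMem_of_Ble hC hk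
    (Ble_some_none_iff.2 (Or.inr (Or.inr (Or.inr ⟨k, k, s, rfl, le_rfl, rfl, rfl, rfl⟩))))⟩

/-- Along an increasing sequence of words, some `(f p (s N), n + 1, ⊤)` escapes from `C` as soon
as `(p.1.1, n, ⊤)` does. -/
lemma exists_word_notMem (hif : IFData i f) {C : Set (P1t × P2t i φ)}
    (hC : ScottClosed' (prodLe i φ f) C) {n : ℕ} (p : Pairt)
    (hmn : diagPt i φ (p.1.1, n, none) ∉ C) {s : ℕ → NWord}
    (hmono : ∀ N N', N ≤ N' → wordLE (s N) (s N')) (hs : ∀ N, N ≤ (s N).1.length) :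
    ∃ N, diagPt i φ (f p (s N), n + 1, none) ∉ C := by
  obtain ⟨N, hN⟩ := exists_chain_notMem hif hC hmn p (y := fun N => Sum.inr (s N)) hmono hs
  exact ⟨N, notMem_of_Ble hC hN (Ble_some_none_iff.2
    (Or.inr (Or.inl ⟨s N, s N, rfl, List.prefix_refl _, rfl, rfl, rfl⟩)))⟩

lemma exists_notMem_both_of_lt (hif : IFData i f) {C₁ C₂ : Set (P1t × P2t i φ)}
    (hC₁ : ScottClosed' (prodLe i φ f) C₁) (hC₂ : ScottClosed' (prodLe i φ f) C₂)
    {m₁ m₂ n : ℕ} (hlt : m₁ < m₂) (h₁ : diagPt i φ (m₁, n, none) ∉ C₁)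
    (h₂ : diagPt i φ (m₂, n, none) ∉ C₂) :
    ∃ m k, diagPt i φ (m, k, none) ∉ C₁ ∧ diagPt i φ (m, k, none) ∉ C₂ := by
  let p : Pairt := ⟨(m₁, m₂), hlt⟩
  obtain ⟨k₀, hk₀⟩ := exists_word1_notMem hif hC₂ p h₂
  choose nxt hnxt using fun s => exists_wordSnoc_notMem hif hC₂ (n := n + 1) p s
  let W := {s : NWord // diagPt i φ (f p s, n + 1, none) ∉ C₂}
  let F : ℕ → W := fun N => Nat.rec (⟨word1 k₀, hk₀⟩ : W)
    (fun _ s => ⟨wordSnoc s.1 (nxt s.1 s.2), hnxt s.1 s.2⟩) N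
  have hF : ∀ N, (F (N + 1)).1 = wordSnoc (F N).1 (nxt (F N).1 (F N).2) := fun N => rfl
  obtain ⟨N, hN⟩ := exists_word_notMem hif hC₁ p h₁ (s := fun N => (F N).1) (by
    intro N N' h
    induction N', h using Nat.le_induction with
    | base => exact List.prefix_refl _
    | succ N' _ ih =>
      refine List.IsPrefix.trans ih ?_
      rw [hF]
      exact List.prefix_append _ _) (by
    intro N
    induction N with
    | zero => exact Nat.zero_le _
    | succ N ih =>
      rw [hF]
      simpa [wordSnoc] using ih)
  exact ⟨_, _, hN, (F N).2⟩

lemma exists_notMem_add (hif : IFData i f) {C : Set (P1t × P2t i φ)}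
    (hC : ScottClosed' (prodLe i φ f) C) {m n : ℕ} (hmn : diagPt i φ (m, n, none) ∉ C) (k : ℕ) :
    ∃ m', diagPt i φ (m', n + k, none) ∉ C := by
  induction k with
  | zero => exact ⟨m, hmn⟩
  | succ k ih =>
    obtain ⟨m', h⟩ := ih
    obtain ⟨N, hN⟩ := exists_word_notMem hif hC (⟨(m', m' + 1), Nat.lt_succ_self m'⟩ : Pairt) h
      (s := fun N => ⟨List.replicate (N + 1) 0, by simp⟩)
      (fun N N' h => ⟨List.replicate (N' - N) 0, by
        rw [← List.replicate_add, show N + 1 + (N' - N) = N' + 1 by omega]⟩)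
      (fun N => by simp)
    exact ⟨_, hN⟩

lemma exists_notMem_both (hif : IFData i f) {C₁ C₂ : Set (P1t × P2t i φ)}
    (hC₁ : ScottClosed' (prodLe i φ f) C₁) (hC₂ : ScottClosed' (prodLe i φ f) C₂)
    {m₁ n₁ m₂ n₂ : ℕ} (h₁ : diagPt i φ (m₁, n₁, none) ∉ C₁)
    (h₂ : diagPt i φ (m₂, n₂, none) ∉ C₂) :
    ∃ m k, diagPt i φ (m, k, none) ∉ C₁ ∧ diagPt i φ (m, k, none) ∉ C₂ := by
  obtain ⟨a, ha⟩ := exists_notMem_add hif hC₁ h₁ n₂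
  obtain ⟨b, hb⟩ := exists_notMem_add hif hC₂ h₂ n₁
  rw [add_comm] at hb
  rcases lt_trichotomy a b with h | rfl | h
  · exact exists_notMem_both_of_lt hif hC₁ hC₂ h ha hb
  · exact ⟨a, _, ha, hb⟩
  · obtain ⟨m, k, h2, h1⟩ := exists_notMem_both_of_lt hif hC₂ hC₁ h hb ha
    exact ⟨m, k, h1, h2⟩

lemma exists_diagPt_notMem {C : Set (P1t × P2t i φ)} (hC : ScottClosed' (prodLe i φ f) C)
    (h : ¬ Adiag i φ f ⊆ C) : ∃ m n, diagPt i φ (m, n, none) ∉ C := by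
  obtain ⟨q, ⟨b, hb, hqb⟩, hq⟩ := Set.not_subset.1 h
  obtain ⟨m, n, rfl⟩ := mem_maxB_iff.1 hb
  exact ⟨m, n, fun h => hq (hC.1 _ _ hqb h)⟩

end Irreducible

/-- The set `A = ↓{(a, a) : a ∈ max B} ⊆ P₁ × P₂` is an irreducible closed
subset of the Scott space `Σ(P₁ × P₂)` which is not of the form `↓x` for any
`x ∈ P₁ × P₂`. -/
theorem Adiag_irreducible_closed_not_principal (i : Pairt → Set ℕ) (f : Pairt → NWord → ℕ)
    (φ : ℕ → Pairt) (hif : IFData i f) (hφ : Function.Bijective φ) :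
    ScottClosed' (prodLe i φ f) (Adiag i φ f) ∧
    (Adiag i φ f).Nonempty ∧
    (∀ C₁ C₂ : Set (P1t × P2t i φ), ScottClosed' (prodLe i φ f) C₁ →
      ScottClosed' (prodLe i φ f) C₂ → Adiag i φ f ⊆ C₁ ∪ C₂ →
      Adiag i φ f ⊆ C₁ ∨ Adiag i φ f ⊆ C₂) ∧
    ¬ ∃ x : P1t × P2t i φ, Adiag i φ f = {y | prodLe i φ f y x} := by
  refine ⟨Adiag_scottClosed hif hφ.injective, ⟨_, diagPt_mem_Adiag 0 0⟩, ?_, ?_⟩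
  · intro C₁ C₂ hC₁ hC₂ hsub
    by_contra hcon
    rw [not_or] at hcon
    obtain ⟨m₁, n₁, h₁⟩ := exists_diagPt_notMem hC₁ hcon.1
    obtain ⟨m₂, n₂, h₂⟩ := exists_diagPt_notMem hC₂ hcon.2
    obtain ⟨m, k, h1, h2⟩ := exists_notMem_both hif hC₁ hC₂ h₁ h₂
    exact (hsub (diagPt_mem_Adiag m k)).elim h1 h2
  · rintro ⟨x, hx⟩
    have hxA : x ∈ Adiag i φ f := hx ▸ prodLe_refl x
    obtain ⟨t, ht, -⟩ := mem_Adiag_iff.1 hxA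
    have hall : ∀ m n, t = (m, n) := by
      intro m n
      have h1 : diagPt i φ (m, n, none) ∈ {y | prodLe i φ f y x} :=
        hx ▸ diagPt_mem_Adiag m n
      have h2 := (chainExt_P1 f).upMax_anti h1.1 ht
      have h3 := Ble_none_left (((chainExt_P1 f).upMax_ofB _).subset h2)
      simp only [Prod.mk.injEq] at h3
      exact Prod.ext h3.1 h3.2.1
    have h01 := (hall 0 0).symm.trans (hall 1 0)
    simp at h01
end
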